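/- Let μ₂ be the indicator function of the squarefree numbers. Then ∑_{n ≤ x} μ₂(⌊x/n⌋) = C · x + O(x^{11/29} (log x)²) as x → ∞, where C = ∑_{n=1}^∞ μ₂(n)/(n(n+1)). -/

import Mathlib

open Finset Filter Asymptotics

/-- `muk k n` is the indicator of the `k`-free numbers: `muk k n = 1` if no `k`-th power of
a prime divides `n`, and `muk k n = 0` otherwise. -/
noncomputable def muk (k n : ℕ) : ℝ :=
  letI := Classical.dec (∀ p : ℕ, p.Prime → ¬ p ^ k ∣ n)
  if ∀ p : ℕ, p.Prime → ¬ p ^ k ∣ n then 1 else 0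

/-- The sawtooth function `{y} - 1/2`. -/
noncomputable def sawtooth (y : ℝ) : ℝ := Int.fract y - 1 / 2

theorem abs_sawtooth_le (y : ℝ) : |sawtooth y| ≤ 1 / 2 := by
  unfold sawtooth
  rw [abs_le]
  constructor <;> linarith [Int.fract_nonneg y, Int.fract_lt_one y]

theorem sum_range_affine_mod {q : ℕ} (hq : 0 < q) {p : ℤ} (hp : IsCoprime p (q : ℤ)) (c : ℤ)
    (F : ℕ → ℝ) :
    ∑ m ∈ range q, F (((c + p * m) % q).toNat) = ∑ r ∈ range q, F r := by
  have hq' : (0 : ℤ) < q := by exact_mod_cast hq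
  have hmaps : Set.MapsTo (fun m : ℕ => ((c + p * m) % q).toNat) (range q) (range q) := by
    intro m _
    have h1 := Int.emod_lt_of_pos (c + p * m) hq'
    have h2 := Int.emod_nonneg (c + p * m) hq'.ne'
    simp only [coe_range, Set.mem_Iio]
    omega
  have hinj : Set.InjOn (fun m : ℕ => ((c + p * m) % q).toNat) (range q) := by
    intro m hm m' hm' h
    simp only [coe_range, Set.mem_Iio] at hm hm' h
    have h2 := Int.emod_nonneg (c + p * m) hq'.ne'
    have h2' := Int.emod_nonneg (c + p * m') hq'.ne'
    have h3 : (c + p * m) % q = (c + p * m') % q := by omega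
    have h4 : (q : ℤ) ∣ p * ((m : ℤ) - m') := by
      have := Int.emod_emod_of_dvd (c + p * m) (dvd_refl (q : ℤ))
      have h5 := Int.ModEq.dvd (show (c + p * m') ≡ (c + p * m) [ZMOD q] from h3.symm)
      have h6 : c + p * (m : ℤ) - (c + p * m') = p * ((m : ℤ) - m') := by ring
      rwa [h6] at h5
    have h7 : (q : ℤ) ∣ (m : ℤ) - m' := hp.symm.dvd_of_dvd_mul_left h4
    have h8 : (m : ℤ) - m' = 0 := by
      apply Int.eq_zero_of_abs_lt_dvd h7
      rw [abs_lt]; constructor <;> omega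
    omega
  exact sum_nbij (fun m : ℕ => ((c + p * m) % q).toNat) hmaps hinj
    (surjOn_of_injOn_of_card_le _ hmaps hinj le_rfl) (fun _ _ => rfl)

theorem abs_sum_sawtooth_rational_le {q : ℕ} (hq : 0 < q) {p : ℤ} (hp : IsCoprime p (q : ℤ))
    (α : ℝ) (w : ℕ → ℝ) (hw : ∀ m < q, |w m| ≤ 2 / q) :
    |∑ m ∈ range q, sawtooth (α + p * m / q + w m)| ≤ 6 := by
  have hqR : (0 : ℝ) < q := by exact_mod_cast hq
  have hq' : (0 : ℤ) < q := by exact_mod_cast hq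
  set c : ℤ := ⌊(q : ℝ) * α⌋ with hc
  have key : ∀ m ∈ range q,
      (((c + p * m) % q).toNat - 2 : ℝ) / q - (if q - 3 ≤ ((c + p * m) % q).toNat then 1 else 0)
        ≤ Int.fract (α + p * m / q + w m) ∧
      Int.fract (α + p * m / q + w m) ≤
        (((c + p * m) % q).toNat + 3 : ℝ) / q +
          (if ((c + p * m) % q).toNat < 2 then 1 else 0) := by
    intro m hm
    have h1 := Int.emod_lt_of_pos (c + p * m) hq'
    have h2 := Int.emod_nonneg (c + p * m) hq'.ne'
    obtain ⟨r, hr⟩ : ∃ r : ℕ, (c + p * m) % q = r := Int.eq_ofNat_of_zero_le h2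
    have hrq : r < q := by omega
    rw [hr, Int.toNat_natCast]
    set k : ℤ := (c + p * m) / q
    have hk : (c : ℝ) + p * m = q * k + r := by
      have := Int.mul_ediv_add_emod (c + p * m) q
      rw [hr] at this
      exact_mod_cast this.symm
    set z : ℝ := ((r : ℝ) + Int.fract ((q : ℝ) * α)) / q + w m with hz
    have hfr : Int.fract (α + p * m / q + w m) = Int.fract z := by
      have : α + p * m / q + w m = z + (k : ℤ) := by
        have h3 : (q : ℝ) * α = c + Int.fract ((q : ℝ) * α) := (Int.floor_add_fract _).symm
        rw [hz]
        generalize Int.fract ((q : ℝ) * α) = β at h3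
        field_simp
        linarith
      rw [this, Int.fract_add_intCast]
    rw [hfr]
    have hwm := abs_le.1 (hw m (mem_range.1 hm))
    have hf0 := Int.fract_nonneg ((q : ℝ) * α)
    have hf1 := (Int.fract_lt_one ((q : ℝ) * α)).le
    have hzl : ((r : ℝ) - 2) / q ≤ z := by
      have : ((r : ℝ) - 2) / q + Int.fract ((q : ℝ) * α) / q - z = -2 / q - w m := by
        rw [hz]; ring
      have h0 : 0 ≤ Int.fract ((q : ℝ) * α) / q := by positivity
      have : -(2 / q : ℝ) = -2 / q := by ring
      linarith
    have hzu : z ≤ ((r : ℝ) + 3) / q := by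
      have h0 : (Int.fract ((q : ℝ) * α)) / q ≤ 1 / q := by gcongr
      have : ((r : ℝ) + 3) / q - z = 2 / q - w m + (1 / q - Int.fract ((q : ℝ) * α) / q) := by
        rw [hz]; ring
      linarith
    have hz0 := Int.fract_nonneg z
    have hz1 := Int.fract_lt_one z
    have hrqR : (r : ℝ) < q := by exact_mod_cast hrq
    constructor
    · by_cases h : z < 1
      · have hfl : (⌊z⌋ : ℝ) ≤ 0 := by
          have : ⌊z⌋ < 1 := Int.floor_lt.2 (by exact_mod_cast h)
          exact_mod_cast Int.lt_add_one_iff.1 this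
        have := Int.floor_add_fract z
        split_ifs <;> linarith
      · push Not at h
        have h4 : (q : ℝ) ≤ r + 3 := by
          have := h.trans hzu
          rwa [le_div_iff₀ hqR, one_mul] at this
        have h5 : q ≤ r + 3 := by exact_mod_cast h4
        rw [if_pos (by omega)]
        have : ((r : ℝ) - 2) / q ≤ 1 := by rw [div_le_one hqR]; linarith
        linarith
    · by_cases h : 0 ≤ z
      · have hfl : (0 : ℝ) ≤ ⌊z⌋ := by exact_mod_cast Int.floor_nonneg.2 h
        have := Int.floor_add_fract z
        split_ifs <;> linarith
      · push Not at h
        have h4 : (r : ℝ) < 2 := by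
          have := hzl.trans_lt h
          rw [div_lt_iff₀ hqR] at this
          linarith
        have h5 : r < 2 := by exact_mod_cast h4
        rw [if_pos h5]
        have : 0 ≤ ((r : ℝ) + 3) / q := by positivity
        linarith
  have hsum : ∑ r ∈ range q, (r : ℝ) = q * (q - 1) / 2 := by
    have := Finset.sum_range_id_mul_two q
    have h2 : ((∑ r ∈ range q, r : ℕ) : ℝ) * 2 = q * (q - 1) := by
      rw [← Nat.cast_pred hq]; exact_mod_cast this
    push_cast at h2
    linarith
  have hup := sum_le_sum fun m hm => (key m hm).2
  have hlo := sum_le_sum fun m hm => (key m hm).1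
  rw [sum_range_affine_mod hq hp c
    (fun r => ((r : ℝ) + 3) / q + (if r < 2 then 1 else 0))] at hup
  rw [sum_range_affine_mod hq hp c
    (fun r => ((r : ℝ) - 2) / q - (if q - 3 ≤ r then 1 else 0))] at hlo
  have hcu : ∑ r ∈ range q, (if r < 2 then (1 : ℝ) else 0) ≤ 2 := by
    rw [sum_boole]
    have : ((range q).filter (· < 2)).card ≤ 2 := by
      calc _ ≤ (range 2).card := card_le_card (by intro a; simp)
        _ = 2 := by simp
    exact_mod_cast this
  have hcl : ∑ r ∈ range q, (if q - 3 ≤ r then (1 : ℝ) else 0) ≤ 3 := by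
    rw [sum_boole]
    have : ((range q).filter (q - 3 ≤ ·)).card ≤ 3 := by
      calc _ ≤ (Ico (q - 3) q).card := card_le_card (by intro a; simp; omega)
        _ ≤ 3 := by simp; omega
    exact_mod_cast this
  rw [sum_add_distrib, ← sum_div, sum_add_distrib, hsum] at hup
  rw [sum_sub_distrib, ← sum_div, sum_sub_distrib, hsum] at hlo
  simp only [sum_const, card_range, nsmul_eq_mul] at hup hlo
  have e1 : ((q : ℝ) * (q - 1) / 2 + q * 3) / q = (q - 1) / 2 + 3 := by field_simp
  have e2 : ((q : ℝ) * (q - 1) / 2 - q * 2) / q = (q - 1) / 2 - 2 := by field_simp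
  rw [e1] at hup
  rw [e2] at hlo
  simp only [sawtooth, sum_sub_distrib, sum_const, card_range, nsmul_eq_mul]
  rw [abs_le]
  constructor <;> linarith

theorem card_le_of_separated {S : Finset ℕ} {q : ℕ} (hq : 0 < q) {L : ℝ} (hL : 0 ≤ L)
    (h : ∀ s ∈ S, ∀ s' ∈ S, s < s' → s + q ≤ s' ∧ ((s' : ℝ) - s) ≤ L) :
    (S.card : ℝ) ≤ L / q + 1 := by
  rcases S.eq_empty_or_nonempty with rfl | hS
  · simp; positivity
  have hqR : (0 : ℝ) < q := by exact_mod_cast hq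
  set a := S.min' hS
  have ha : a ∈ S := S.min'_mem hS
  have hmin : ∀ s ∈ S, a ≤ s := fun s hs => S.min'_le s hs
  have hcard : S.card ≤ (range (⌊L / q⌋₊ + 1)).card := by
    apply card_le_card_of_injOn (fun s => (s - a) / q)
    · intro s hs
      simp only [coe_range, Set.mem_Iio, Nat.lt_succ_iff]
      apply Nat.le_floor
      refine Nat.cast_div_le.trans ?_
      rw [Nat.cast_sub (hmin s hs)]
      gcongr
      rcases (hmin s hs).eq_or_lt with h1 | h1
      · rw [h1]; simpa using hL
      · exact (h a ha s hs h1).2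
    · have aux : ∀ s ∈ S, ∀ s' ∈ S, s < s' → (s - a) / q < (s' - a) / q := by
        intro s hs s' hs' hlt
        have h1 := (h s hs s' hs' hlt).1
        have h2 := hmin s hs
        calc (s - a) / q < (s - a + q) / q := by rw [Nat.add_div_right _ hq]; omega
          _ ≤ (s' - a) / q := Nat.div_le_div_right (by omega)
      intro s hs s' hs' heq
      simp only at heq
      rcases lt_trichotomy s s' with h1 | h1 | h1
      · exact absurd heq (aux s hs s' hs' h1).ne
      · exact h1
      · exact absurd heq (aux s' hs' s hs h1).ne'
  rw [card_range] at hcard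
  calc (S.card : ℝ) ≤ ((⌊L / q⌋₊ + 1 : ℕ) : ℝ) := by exact_mod_cast hcard
    _ ≤ L / q + 1 := by
      push_cast
      gcongr
      exact Nat.floor_le (by positivity)

theorem exists_block_starts {den : ℕ → ℕ} {Q T E : ℕ} {F : ℕ → ℝ} {C : ℝ}
    (hden : ∀ n, 0 < den n) (hQ : ∀ n, den n ≤ Q) (hF : ∀ n, |F n| ≤ 1)
    (hblock : ∀ n, T ≤ n → n + den n ≤ E → |∑ m ∈ range (den n), F (n + m)| ≤ C)
    (k n : ℕ) (hn : T ≤ n) (hk : E - n ≤ k) :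
    ∃ S ⊆ Ico n E, (∀ s ∈ S, ∀ s' ∈ S, s < s' → s + den s ≤ s') ∧
      |∑ t ∈ Ico n E, F t| ≤ C * S.card + Q := by
  induction k generalizing n with
  | zero =>
    refine ⟨∅, by simp, by simp, ?_⟩
    rw [Ico_eq_empty (by omega)]
    simp
  | succ k ih =>
    by_cases h : n + den n ≤ E
    · obtain ⟨S, hS, hsep, hsum⟩ := ih (n + den n) (by omega) (by have := hden n; omega)
      have hnS : ∀ s ∈ S, n + den n ≤ s := fun s hs => (mem_Ico.1 (hS hs)).1
      have hn' : n ∉ S := fun hs => by have := hnS n hs; have := hden n; omega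
      refine ⟨insert n S, ?_, ?_, ?_⟩
      · intro s hs
        rcases mem_insert.1 hs with rfl | hs
        · have := hden s; simp; omega
        · have h1 := mem_Ico.1 (hS hs); simp; omega
      · intro s hs s' hs' hlt
        rcases mem_insert.1 hs with h1 | h1 <;> rcases mem_insert.1 hs' with h2 | h2
        · omega
        · exact h1 ▸ hnS s' h2
        · have := hnS s h1; omega
        · exact hsep s h1 s' h2 hlt
      · rw [← sum_Ico_consecutive F (Nat.le_add_right n (den n)) h, card_insert_of_notMem hn',
          sum_Ico_eq_sum_range, Nat.add_sub_cancel_left]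
        have h1 := hblock n hn h
        refine (abs_add_le _ _).trans ?_
        push_cast
        linarith
    · refine ⟨∅, by simp, by simp, ?_⟩
      refine (abs_sum_le_sum_abs _ _).trans ?_
      calc ∑ t ∈ Ico n E, |F t| ≤ ∑ t ∈ Ico n E, (1 : ℝ) := sum_le_sum fun t _ => hF t
        _ = (E - n : ℕ) := by simp
        _ ≤ Q := by
          have := hQ n
          exact_mod_cast (by omega : E - n ≤ Q)
        _ = _ := by simp

theorem sum_Icc_inv_le_one_add_log (n : ℕ) :
    ∑ i ∈ Icc 1 n, (1 : ℝ) / i ≤ 1 + Real.log n := by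
  have h := harmonic_le_one_add_log n
  rw [harmonic_eq_sum_Icc] at h
  push_cast at h
  simpa [one_div] using h

/-- Blocks attached to rationals `p / q` with `q ≤ Q` are few, if those attached to a given
rational are few. -/
theorem card_le_of_card_fiber_le {S : Finset ℕ} {r : ℕ → ℚ} {Q : ℕ} {A B : ℝ} (hB : 0 ≤ B)
    (hA : 1 ≤ A)
    (hden : ∀ s ∈ S, (r s).den ≤ Q)
    (hnum : ∀ s ∈ S, 0 ≤ (r s).num ∧ ((r s).num : ℝ) ≤ A * (r s).den)
    (hfiber : ∀ q : ℕ, 0 < q → q ≤ Q → ∀ p : ℤ,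
      (((S.filter fun s => (r s).den = q).filter fun s => (r s).num = p).card : ℝ)
        ≤ B / (q : ℝ) ^ 2) :
    (S.card : ℝ) ≤ 2 * A * B * (1 + Real.log Q) := by
  have h1 : S.card = ∑ q ∈ Icc 1 Q, (S.filter fun s => (r s).den = q).card :=
    card_eq_sum_card_fiberwise fun s hs => by
      simpa using ⟨(r s).den_pos, hden s hs⟩
  have h2 : ∀ q ∈ Icc 1 Q,
      ((S.filter fun s => (r s).den = q).card : ℝ) ≤ 2 * A * B * (1 / q) := by
    intro q hq
    rw [mem_Icc] at hq
    have hqR : (1 : ℝ) ≤ q := by exact_mod_cast hq.1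
    have h3 : (S.filter fun s => (r s).den = q).card = ∑ p ∈ Icc (0 : ℤ) ⌊A * q⌋,
        ((S.filter fun s => (r s).den = q).filter fun s => (r s).num = p).card :=
      card_eq_sum_card_fiberwise fun s hs => by
        rw [mem_coe, mem_filter] at hs
        have h4 := hnum s hs.1
        rw [hs.2] at h4
        rw [mem_coe, mem_Icc]
        exact ⟨h4.1, Int.le_floor.2 h4.2⟩
    rw [h3]
    push_cast
    have hAq : 1 ≤ A * q := by nlinarith
    calc _ ≤ ∑ p ∈ Icc (0 : ℤ) ⌊A * q⌋, B / (q : ℝ) ^ 2 :=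
          sum_le_sum fun p _ => hfiber q hq.1 hq.2 p
      _ = (⌊A * q⌋ + 1 : ℤ).toNat * (B / (q : ℝ) ^ 2) := by simp
      _ ≤ (2 * (A * q)) * (B / (q : ℝ) ^ 2) := by
        gcongr
        have h5 : (0 : ℤ) ≤ ⌊A * q⌋ + 1 := by
          have : (0 : ℤ) ≤ ⌊A * q⌋ := Int.floor_nonneg.2 (by linarith)
          omega
        have h6 : (((⌊A * q⌋ + 1 : ℤ).toNat : ℤ) : ℝ) = ((⌊A * q⌋ + 1 : ℤ) : ℝ) := by
          rw [Int.toNat_of_nonneg h5]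
        rw [Int.cast_natCast] at h6
        rw [h6]
        push_cast
        linarith [Int.floor_le (A * q)]
      _ = _ := by field_simp
  rw [h1]
  push_cast
  calc _ ≤ ∑ q ∈ Icc 1 Q, 2 * A * B * (1 / (q : ℝ)) := sum_le_sum h2
    _ = 2 * A * B * ∑ q ∈ Icc 1 Q, (1 / (q : ℝ)) := by rw [mul_sum]
    _ ≤ _ := by
      gcongr
      exact sum_Icc_inv_le_one_add_log Q

theorem sub_le_of_inv_sq_sub_le {Y T Q q u u' : ℝ} (hY : 0 < Y) (hT : 0 < T) (hQ : 0 < Q)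
    (hq : 0 < q) (hTQ : T ^ 3 ≤ (Q + 1) ^ 3 * Y ^ 3) (hu : T ≤ u) (hu3 : u ≤ 3 * T)
    (hu' : T ≤ u') (hu3' : u' ≤ 3 * T) (hlt : u < u')
    (h : Y ^ 3 / u ^ 2 - Y ^ 3 / u' ^ 2 ≤ 2 * (1 / ((Q + 1) * q))) :
    u' - u ≤ 81 * (Q + 1) ^ 2 / q := by
  have hu0 : 0 < u := by linarith
  have hu0' : 0 < u' := by linarith
  have hd0 : 0 < u' - u := by linarith
  have h1 : 2 / (81 * T ^ 3) ≤ (u + u') / (u ^ 2 * u' ^ 2) := by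
    rw [div_le_div_iff₀ (by positivity) (by positivity)]
    have e1 : u ^ 2 * u' ^ 2 ≤ (3 * T) ^ 2 * (3 * T) ^ 2 := by gcongr
    calc 2 * (u ^ 2 * u' ^ 2) ≤ 2 * ((3 * T) ^ 2 * (3 * T) ^ 2) := by gcongr
      _ = (T + T) * (81 * T ^ 3) := by ring
      _ ≤ (u + u') * (81 * T ^ 3) := by gcongr
  have h2 : Y ^ 3 * (u' - u) * (2 / (81 * T ^ 3)) ≤ 2 * (1 / ((Q + 1) * q)) := by
    calc _ ≤ Y ^ 3 * (u' - u) * ((u + u') / (u ^ 2 * u' ^ 2)) := by gcongr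
      _ = Y ^ 3 / u ^ 2 - Y ^ 3 / u' ^ 2 := by field_simp; ring
      _ ≤ _ := h
  have h3 : Y ^ 3 * (u' - u) * (2 / (81 * T ^ 3)) = 2 * (Y ^ 3 * (u' - u)) / (81 * T ^ 3) := by
    ring
  have h4 : 2 * (1 / ((Q + 1) * q)) = 2 / ((Q + 1) * q) := by ring
  rw [h3, h4, div_le_div_iff₀ (by positivity) (by positivity)] at h2
  rw [le_div_iff₀ hq]
  have h5 : Y ^ 3 * (Q + 1) * ((u' - u) * q) ≤ Y ^ 3 * (Q + 1) * (81 * (Q + 1) ^ 2) := by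
    nlinarith
  exact le_of_mul_le_mul_left h5 (by positivity)

/-- Voronoi's bound on a dyadic interval. -/
theorem abs_sum_Ico_sawtooth_le {Y ρ : ℝ} (hY : 1 ≤ Y) (c : ℝ) (hρ0 : 0 ≤ ρ) (hρ1 : ρ ≤ 1)
    {T E : ℕ} (hYT : Y ≤ T) (hT : (T : ℝ) ^ 2 ≤ Y ^ 3) (hE : E ≤ 2 * T) :
    |∑ t ∈ Ico T E, sawtooth (Y ^ 3 / (t + ρ) + c)| ≤ 10000 * Y * (1 + Real.log Y) := by
  have hY0 : 0 < Y := by linarith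
  have hT0 : (1 : ℝ) ≤ T := hY.trans hYT
  have hT00 : (0 : ℝ) < T := by linarith
  set Q := ⌊(T : ℝ) / Y⌋₊ with hQdef
  have hQ1 : 1 ≤ Q := Nat.le_floor (by rw [Nat.cast_one, le_div_iff₀ hY0]; linarith)
  have hQ1R : (1 : ℝ) ≤ Q := by exact_mod_cast hQ1
  have hQT : (Q : ℝ) * Y ≤ T := by
    rw [← le_div_iff₀ hY0]; exact Nat.floor_le (by positivity)
  have hTQ : (T : ℝ) ≤ (Q + 1) * Y := by
    rw [← div_le_iff₀ hY0]; exact (Nat.lt_floor_add_one _).le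
  have hTY : (T : ℝ) ≤ Y * Y := by
    have : (T : ℝ) ^ 2 ≤ (Y * Y) ^ 2 := hT.trans (by nlinarith [pow_pos hY0 3])
    exact (pow_le_pow_iff_left₀ hT00.le (by positivity) two_ne_zero).1 this
  have hQY : (Q : ℝ) ≤ Y := by
    have : (Q : ℝ) * Y ≤ Y * Y := hQT.trans hTY
    exact le_of_mul_le_mul_right this hY0
  have hQY3 : Y ^ 3 * (Q : ℝ) ^ 3 ≤ (T : ℝ) ^ 3 := by
    have : ((Q : ℝ) * Y) ^ 3 ≤ (T : ℝ) ^ 3 := by gcongr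
    calc _ = ((Q : ℝ) * Y) ^ 3 := by ring
      _ ≤ _ := this
  have hTQ3 : (T : ℝ) ^ 3 ≤ (Q + 1) ^ 3 * Y ^ 3 := by
    have : (T : ℝ) ^ 3 ≤ ((Q + 1) * Y) ^ 3 := by gcongr
    calc _ ≤ _ := this
      _ = _ := by ring
  choose r hr hrden using fun n : ℕ =>
    Real.exists_rat_abs_sub_le_and_den_le (Y ^ 3 / ((n : ℝ) + ρ) ^ 2) hQ1
  have hblock : ∀ n, T ≤ n → n + (r n).den ≤ E →
      |∑ m ∈ range (r n).den, sawtooth (Y ^ 3 / (((n + m : ℕ) : ℝ) + ρ) + c)| ≤ 6 := by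
    intro n hn _
    have hnR : (T : ℝ) ≤ n := by exact_mod_cast hn
    set q := (r n).den with hq
    have hq0 : 0 < q := (r n).den_pos
    have hqR : (0 : ℝ) < q := by exact_mod_cast hq0
    have hqQ : (q : ℝ) ≤ Q := by exact_mod_cast hrden n
    set s : ℝ := (n : ℝ) + ρ with hs
    have hsT : (T : ℝ) ≤ s := by linarith
    have hs0 : 0 < s := by linarith
    have hcop : IsCoprime (-(r n).num) (q : ℤ) := by
      rw [IsCoprime.neg_left_iff]
      exact Rat.isCoprime_num_den (r n)
    have hrn : (r n : ℝ) = (r n).num / q := by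
      rw [hq]; exact_mod_cast (Rat.num_div_den (r n)).symm
    have hrr := hr n
    rw [← hs, hrn, ← hq] at hrr
    have := abs_sum_sawtooth_rational_le hq0 hcop (Y ^ 3 / s + c)
      (fun m => m * ((r n).num / q - Y ^ 3 / s ^ 2) + Y ^ 3 * m ^ 2 / (s ^ 2 * (s + m))) ?_
    · refine (congrArg abs (sum_congr rfl fun m _ => congrArg sawtooth ?_)).trans_le this
      have hsm : s + m ≠ 0 := by positivity
      have : ((n + m : ℕ) : ℝ) + ρ = s + m := by rw [hs]; push_cast; ring
      rw [this]
      push_cast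
      field_simp
      ring
    · intro m hm
      have hmq : (m : ℝ) ≤ q := by exact_mod_cast hm.le
      have hm0 : (0 : ℝ) ≤ m := by positivity
      have hmQ : m ≤ Q := hm.le.trans (hrden n)
      have h1 : |(m : ℝ) * ((r n).num / q - Y ^ 3 / s ^ 2)| ≤ 1 / q := by
        rw [abs_mul, abs_of_nonneg hm0, abs_sub_comm]
        calc _ ≤ (q : ℝ) * (1 / ((Q + 1) * q)) := by gcongr
          _ = 1 / (Q + 1) := by field_simp
          _ ≤ 1 / q := by gcongr; linarith
      have h2 : |Y ^ 3 * (m : ℝ) ^ 2 / (s ^ 2 * (s + m))| ≤ 1 / q := by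
        rw [abs_of_nonneg (by positivity)]
        rw [div_le_div_iff₀ (by positivity) hqR, one_mul]
        calc Y ^ 3 * (m : ℝ) ^ 2 * q ≤ Y ^ 3 * (Q : ℝ) ^ 2 * Q := by
              gcongr
          _ = Y ^ 3 * (Q : ℝ) ^ 3 := by ring
          _ ≤ (T : ℝ) ^ 3 := hQY3
          _ = T ^ 2 * T := by ring
          _ ≤ s ^ 2 * (s + m) := by gcongr; linarith
      calc _ ≤ _ := abs_add_le _ _
        _ ≤ 1 / (q : ℝ) + 1 / q := add_le_add h1 h2
        _ = 2 / q := by ring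
  obtain ⟨S, hS, hsep, hsum⟩ := exists_block_starts (den := fun n => (r n).den) (Q := Q)
    (T := T) (E := E) (F := fun t => sawtooth (Y ^ 3 / ((t : ℝ) + ρ) + c)) (C := 6)
    (fun n => (r n).den_pos) hrden (fun n => (abs_sawtooth_le _).trans (by norm_num))
    hblock (E - T) T le_rfl le_rfl
  have hA : 1 ≤ Y ^ 3 / (T : ℝ) ^ 2 := by rw [le_div_iff₀ (by positivity)]; linarith
  have hSb : ∀ s ∈ S, (T : ℝ) ≤ s + ρ ∧ (s : ℝ) + ρ ≤ 3 * T := by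
    intro s hs
    have h1 := mem_Ico.1 (hS hs)
    have h2 : (T : ℝ) ≤ s := by exact_mod_cast h1.1
    have h3 : (s : ℝ) ≤ 2 * T := by exact_mod_cast h1.2.le.trans hE
    constructor <;> linarith
  have hcard := card_le_of_card_fiber_le (S := S) (r := r) (Q := Q)
    (A := 2 * (Y ^ 3 / (T : ℝ) ^ 2)) (B := 82 * ((Q : ℝ) + 1) ^ 2) (by positivity) (by linarith)
    (fun s _ => hrden s) ?_ ?_
  · have hlogQ : Real.log Q ≤ Real.log Y := Real.log_le_log (by linarith) hQY
    have hlogQ0 : 0 ≤ Real.log Q := Real.log_nonneg hQ1R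
    have h1 : 2 * (2 * (Y ^ 3 / (T : ℝ) ^ 2)) * (82 * ((Q : ℝ) + 1) ^ 2) ≤ 1312 * Y := by
      have : ((Q : ℝ) + 1) ^ 2 * Y ^ 2 ≤ (2 * T) ^ 2 := by
        calc ((Q : ℝ) + 1) ^ 2 * Y ^ 2 ≤ (2 * Q) ^ 2 * Y ^ 2 := by gcongr; linarith
          _ = (2 * (Q * Y)) ^ 2 := by ring
          _ ≤ _ := by gcongr
      calc _ = 328 * Y * (((Q : ℝ) + 1) ^ 2 * Y ^ 2) / T ^ 2 := by field_simp; ring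
        _ ≤ 328 * Y * (2 * T) ^ 2 / T ^ 2 := by gcongr
        _ = _ := by field_simp; ring
    have h2 : (S.card : ℝ) ≤ 1312 * Y * (1 + Real.log Y) :=
      hcard.trans (mul_le_mul h1 (by linarith) (by linarith) (by positivity))
    have h3 : Y ≤ Y * (1 + Real.log Y) := by nlinarith
    calc _ ≤ 6 * (S.card : ℝ) + Q := hsum
      _ ≤ 10000 * Y * (1 + Real.log Y) := by nlinarith
  · intro s hs
    obtain ⟨hb1, hb2⟩ := hSb s hs
    have hq0 : (0 : ℝ) < (r s).den := by exact_mod_cast (r s).den_pos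
    have hq1 : (1 : ℝ) ≤ (r s).den := by exact_mod_cast (r s).den_pos
    have hrn : (r s : ℝ) = (r s).num / (r s).den := by
      exact_mod_cast (Rat.num_div_den (r s)).symm
    have h1 := abs_le.1 (hr s)
    rw [hrn] at h1
    have hs0 : 0 < (s : ℝ) + ρ := by linarith
    have hθ : 0 < Y ^ 3 / ((s : ℝ) + ρ) ^ 2 := by positivity
    have hθ' : Y ^ 3 / ((s : ℝ) + ρ) ^ 2 ≤ Y ^ 3 / (T : ℝ) ^ 2 := by gcongr
    have h3 : (1 : ℝ) / ((Q + 1) * (r s).den) * (r s).den = 1 / (Q + 1) := by field_simp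
    have h4 : (1 : ℝ) / (Q + 1) < 1 := by rw [div_lt_one (by linarith)]; linarith
    have h5 : ((r s).num : ℝ) / (r s).den * (r s).den = (r s).num := by field_simp
    constructor
    · have : (-1 : ℝ) < (r s).num := by
        rw [← h5]
        nlinarith [h1.2]
      have : (-1 : ℤ) < (r s).num := by exact_mod_cast this
      omega
    · rw [← h5]
      nlinarith [h1.1]
  · intro q hq0 hqQ p
    have hqR : (0 : ℝ) < q := by exact_mod_cast hq0
    have hqQR : (q : ℝ) ≤ Q := by exact_mod_cast hqQ
    refine (card_le_of_separated hq0 (L := 81 * ((Q : ℝ) + 1) ^ 2 / q) (by positivity) ?_).trans ?_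
    · intro s hs s' hs' hlt
      simp only [mem_filter] at hs hs'
      refine ⟨hs.1.2 ▸ hsep s hs.1.1 s' hs'.1.1 hlt, ?_⟩
      have hrr : r s = r s' := Rat.ext (hs.2.trans hs'.2.symm) (hs.1.2.trans hs'.1.2.symm)
      have h1 := abs_le.1 (hr s)
      have h2 := abs_le.1 (hr s')
      rw [← hrr, hs.1.2] at h2
      rw [hs.1.2] at h1
      obtain ⟨hb1, hb2⟩ := hSb s hs.1.1
      obtain ⟨hb1', hb2'⟩ := hSb s' hs'.1.1
      have hltR : (s : ℝ) < s' := by exact_mod_cast hlt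
      set u : ℝ := (s : ℝ) + ρ
      set u' : ℝ := (s' : ℝ) + ρ
      have hd : (s' : ℝ) - s = u' - u := by simp only [u, u']; ring
      rw [hd]
      exact sub_le_of_inv_sq_sub_le hY0 hT00 (by linarith) hqR hTQ3 hb1 hb2 hb1' hb2'
        (by linarith) (by linarith)
    · have : (1 : ℝ) ≤ (Q + 1) ^ 2 / q ^ 2 := by
        rw [le_div_iff₀ (by positivity), one_mul]
        gcongr
        linarith
      calc _ ≤ 81 * ((Q : ℝ) + 1) ^ 2 / q / q + (Q + 1) ^ 2 / q ^ 2 := by gcongr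
        _ = _ := by field_simp; ring

theorem abs_sum_Ico_one_sawtooth_le {Y ρ : ℝ} (hY : 1 ≤ Y) (c : ℝ) (hρ0 : 0 ≤ ρ) (hρ1 : ρ ≤ 1)
    (k M : ℕ) (hM : (M : ℝ) ^ 2 ≤ Y ^ 3) (hk : M + 1 ≤ 2 ^ k) :
    |∑ t ∈ Ico 1 (M + 1), sawtooth (Y ^ 3 / (t + ρ) + c)|
      ≤ Y + k * (10000 * Y * (1 + Real.log Y)) := by
  have hlog : 0 ≤ Real.log Y := Real.log_nonneg hY
  have hY0 : 0 < Y := by linarith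
  induction k generalizing M with
  | zero =>
    obtain rfl : M = 0 := by omega
    simp [hY0.le]
  | succ k ih =>
    rcases Nat.eq_zero_or_pos M with rfl | hM0
    · simp only [zero_add, Ico_self, sum_empty, abs_zero]
      positivity
    obtain ⟨T, hT⟩ : ∃ T, T = (M + 2) / 2 := ⟨_, rfl⟩
    have hT1 : 1 ≤ T := by omega
    have hTM : T ≤ M := by omega
    by_cases hYT : Y ≤ T
    · have hTM' : (T : ℝ) ≤ M := by exact_mod_cast hTM
      have h1 := ih (T - 1) ?_ ?_
      · have h2 := abs_sum_Ico_sawtooth_le hY c hρ0 hρ1 hYT (E := M + 1)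
          ((pow_le_pow_left₀ (by positivity) hTM' 2).trans hM) (by omega)
        rw [Nat.sub_add_cancel hT1] at h1
        rw [← sum_Ico_consecutive _ hT1 (by omega : T ≤ M + 1)]
        refine (abs_add_le _ _).trans ?_
        push_cast
        linarith
      · refine le_trans ?_ hM
        gcongr
        omega
      · rw [pow_succ] at hk; omega
    · push Not at hYT
      refine (abs_sum_le_sum_abs _ _).trans ?_
      have h2 : (M : ℝ) ≤ 2 * T := by exact_mod_cast (by omega : M ≤ 2 * T)
      calc _ ≤ ∑ t ∈ Ico 1 (M + 1), (1 / 2 : ℝ) := sum_le_sum fun t _ => abs_sawtooth_le _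
        _ = M * (1 / 2) := by simp
        _ ≤ Y := by linarith
        _ ≤ _ := le_add_of_nonneg_right (by positivity)

theorem abs_sum_Ioc_sawtooth_le {Y ρ : ℝ} (hY : 1 ≤ Y) (c : ℝ) (hρ0 : 0 ≤ ρ) (hρ1 : ρ ≤ 1)
    {M : ℕ} (hM : (M : ℝ) ^ 2 ≤ Y ^ 3) :
    |∑ t ∈ Ioc 0 M, sawtooth (Y ^ 3 / (t + ρ) + c)| ≤ 40000 * Y * (1 + Real.log Y) ^ 2 := by
  have hlog : 0 ≤ Real.log Y := Real.log_nonneg hY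
  have hY0 : 0 < Y := by linarith
  rcases Nat.eq_zero_or_pos M with rfl | hM0
  · simp; positivity
  have h1 := abs_sum_Ico_one_sawtooth_le hY c hρ0 hρ1 (Nat.log 2 M + 1) M hM
    (Nat.lt_pow_succ_log_self (by norm_num) M)
  have h2 : ((Nat.log 2 M + 1 : ℕ) : ℝ) ≤ 3 * (1 + Real.log Y) := by
    have h3 : ((2 ^ Nat.log 2 M : ℕ) : ℝ) ≤ M := by
      exact_mod_cast Nat.pow_log_le_self 2 hM0.ne'
    have h4 : (M : ℝ) ≤ Y ^ 2 := by
      have : (M : ℝ) ^ 2 ≤ (Y ^ 2) ^ 2 := hM.trans (by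
        rw [← pow_mul]; exact pow_le_pow_right₀ hY (by norm_num))
      exact (pow_le_pow_iff_left₀ (by positivity) (by positivity) two_ne_zero).1 this
    have h5 := Real.log_le_log (by positivity) (h3.trans h4)
    push_cast at h5
    rw [Real.log_pow, Real.log_pow] at h5
    have h6 := Real.log_two_gt_d9
    push_cast at h5 ⊢
    nlinarith [(Nat.cast_nonneg (Nat.log 2 M) : (0 : ℝ) ≤ _)]
  have h7 : Ioc 0 M = Ico 1 (M + 1) := by ext; simp; omega
  rw [h7]
  refine h1.trans ?_
  have h8 : Y ≤ Y * (1 + Real.log Y) ^ 2 := by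
    nlinarith [mul_nonneg hY0.le hlog, mul_nonneg hlog hlog]
  calc _ ≤ Y * (1 + Real.log Y) ^ 2 + 3 * (1 + Real.log Y) * (10000 * Y * (1 + Real.log Y)) := by
        gcongr
    _ ≤ _ := by nlinarith

theorem natCast_floor_eq_sub_sawtooth {y : ℝ} (hy : 0 ≤ y) :
    (⌊y⌋₊ : ℝ) = y - 1 / 2 - sawtooth y := by
  rw [natCast_floor_eq_intCast_floor hy, sawtooth, Int.fract]
  ring

theorem sum_Ioc_ite_le_eq_floor {M L : ℕ} {y : ℝ} (hy : 0 ≤ y) (hM : M ≤ ⌊y⌋₊) (hL : ⌊y⌋₊ ≤ L) :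
    ∑ b ∈ Ioc M L, (if (b : ℝ) ≤ y then (1 : ℝ) else 0) = ⌊y⌋₊ - M := by
  rw [sum_boole]
  have : (Ioc M L).filter (fun b : ℕ => (b : ℝ) ≤ y) = Ioc M ⌊y⌋₊ := by
    ext b
    simp only [mem_filter, mem_Ioc, Nat.le_floor_iff hy]
    constructor
    · rintro ⟨h1, h2⟩; exact ⟨h1.1, h2⟩
    · rintro ⟨h1, h2⟩; exact ⟨⟨h1, (Nat.le_floor h2).trans hL⟩, h2⟩
  rw [this, Nat.card_Ioc, Nat.cast_sub hM]

/-- Dirichlet's hyperbola method for the lattice points `n (b + ρ) ≤ X`. -/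
theorem sum_Ioc_floor_div_add {X ρ : ℝ} (hX : 0 ≤ X) (hρ0 : 0 ≤ ρ) (hρ1 : ρ ≤ 1) (M : ℕ) :
    ∑ b ∈ Ioc M ⌊X⌋₊, (⌊X / (b + ρ)⌋₊ : ℝ)
      = ∑ n ∈ Ioc 0 ⌊X / (M + 1)⌋₊, ((⌊X / n - ρ⌋₊ : ℝ) - M) := by
  set K := ⌊X / ((M : ℝ) + 1)⌋₊ with hK
  have hKX : K ≤ ⌊X⌋₊ := Nat.floor_le_floor
    (div_le_self hX (by linarith [(Nat.cast_nonneg M : (0 : ℝ) ≤ M)]))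
  have h1 : ∀ b ∈ Ioc M ⌊X⌋₊, (⌊X / (b + ρ)⌋₊ : ℝ)
      = ∑ n ∈ Ioc 0 ⌊X⌋₊, (if (n : ℝ) * (b + ρ) ≤ X then (1 : ℝ) else 0) := by
    intro b hb
    rw [mem_Ioc] at hb
    have hb1 : (1 : ℝ) ≤ b := by exact_mod_cast (by omega : 1 ≤ b)
    have hbρ : 0 < (b : ℝ) + ρ := by linarith
    have := sum_Ioc_ite_le_eq_floor (M := 0) (L := ⌊X⌋₊) (y := X / (b + ρ)) (by positivity)
      (Nat.zero_le _) (Nat.floor_le_floor (div_le_self hX (by linarith)))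
    rw [Nat.cast_zero, sub_zero] at this
    rw [← this]
    refine sum_congr rfl fun n _ => ?_
    simp only [le_div_iff₀ hbρ]
  rw [sum_congr rfl h1, sum_comm, ← sum_Ioc_consecutive _ (Nat.zero_le K) hKX]
  have h2 : ∑ n ∈ Ioc K ⌊X⌋₊, ∑ b ∈ Ioc M ⌊X⌋₊,
      (if (n : ℝ) * (b + ρ) ≤ X then (1 : ℝ) else 0) = 0 := by
    refine sum_eq_zero fun n hn => sum_eq_zero fun b hb => if_neg ?_
    rw [mem_Ioc] at hn hb
    have h3 : X / (M + 1) < n := (Nat.floor_lt (by positivity)).1 hn.1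
    rw [div_lt_iff₀ (by positivity)] at h3
    have h4 : (M : ℝ) + 1 ≤ b := by exact_mod_cast hb.1
    push Not
    calc X < n * (M + 1) := h3
      _ ≤ n * (b + ρ) := mul_le_mul_of_nonneg_left (by linarith) (by positivity)
  rw [h2, add_zero]
  refine sum_congr rfl fun n hn => ?_
  rw [mem_Ioc] at hn
  have hn1 : (1 : ℝ) ≤ n := by exact_mod_cast (by omega : 1 ≤ n)
  have hn0 : (0 : ℝ) < n := by linarith
  have h3 : (n : ℝ) ≤ X / (M + 1) := (Nat.le_floor_iff (by positivity)).1 hn.2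
  have h4 : (M : ℝ) + 1 ≤ X / n := by
    rw [le_div_iff₀ (by positivity)] at h3 ⊢
    linarith
  have hM0 : (0 : ℝ) ≤ M := by positivity
  rw [← sum_Ioc_ite_le_eq_floor (L := ⌊X⌋₊) (by linarith) (Nat.le_floor (by linarith))
    (Nat.floor_le_floor (by linarith [div_le_self hX hn1]))]
  refine sum_congr rfl fun b _ => ?_
  have : (n : ℝ) * (b + ρ) ≤ X ↔ (b : ℝ) ≤ X / n - ρ := by
    rw [le_sub_iff_add_le, le_div_iff₀ hn0, mul_comm]
  simp only [this]

theorem sum_Ioc_inv_sub_inv_add_bounds {ρ : ℝ} (hρ0 : 0 ≤ ρ) (hρ1 : ρ ≤ 1) {M L : ℕ} (hM : 0 < M)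
    (hML : M ≤ L) :
    ρ * (1 / ((M : ℝ) + 1) - 1 / (L + 1)) ≤ ∑ b ∈ Ioc M L, (1 / (b : ℝ) - 1 / (b + ρ)) ∧
      ∑ b ∈ Ioc M L, (1 / (b : ℝ) - 1 / (b + ρ)) ≤ ρ * (1 / (M : ℝ) - 1 / L) := by
  have hM' : (0 : ℝ) < M := by exact_mod_cast hM
  induction L, hML using Nat.le_induction with
  | base => simp
  | succ L hML ih =>
    rw [← sum_Ioc_consecutive _ hML (Nat.le_succ L)]
    have hL' : (0 : ℝ) < L := by exact_mod_cast hM.trans_le hML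
    have h1 : Ioc L (L + 1) = {L + 1} := by ext; simp
    rw [h1, sum_singleton]
    push_cast
    have e : 1 / ((L : ℝ) + 1) - 1 / (L + 1 + ρ) = ρ * (1 / ((L + 1) * (L + 1 + ρ))) := by
      field_simp; ring
    have h2 : 1 / (((L : ℝ) + 1) * (L + 1 + ρ)) ≤ 1 / L - 1 / (L + 1) := by
      rw [show 1 / (L : ℝ) - 1 / (L + 1) = 1 / ((L + 1) * L) by field_simp; ring]
      gcongr; linarith
    have h3 : 1 / ((L : ℝ) + 1) - 1 / (L + 1 + 1) ≤ 1 / (((L : ℝ) + 1) * (L + 1 + ρ)) := by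
      rw [show 1 / ((L : ℝ) + 1) - 1 / (L + 1 + 1) = 1 / ((L + 1) * (L + 1 + 1)) by
        field_simp; ring]
      gcongr
    have h4 := mul_le_mul_of_nonneg_left h2 hρ0
    have h5 := mul_le_mul_of_nonneg_left h3 hρ0
    rw [e]
    constructor <;> linarith [ih.1, ih.2]

theorem abs_sum_floor_div_sub_floor_div_add_le {Y ρ : ℝ} (hY : 1 ≤ Y) (hρ0 : 0 ≤ ρ) (hρ1 : ρ ≤ 1) :
    |∑ b ∈ Ioc 0 ⌊Y ^ 3⌋₊, ((⌊Y ^ 3 / b⌋₊ : ℝ) - ⌊Y ^ 3 / (b + ρ)⌋₊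
        - (Y ^ 3 / b - Y ^ 3 / (b + ρ)))| ≤ 200000 * Y * (1 + Real.log Y) ^ 2 := by
  have hY0 : 0 < Y := by linarith
  have hlog : 0 ≤ Real.log Y := Real.log_nonneg hY
  obtain ⟨X, hX⟩ : ∃ X, X = Y ^ 3 := ⟨_, rfl⟩
  have hX1 : 1 ≤ X := hX ▸ one_le_pow₀ hY
  have hX0 : 0 < X := by linarith
  set M := ⌊√X⌋₊ with hM
  set K := ⌊X / ((M : ℝ) + 1)⌋₊ with hK
  have hM1 : 1 ≤ M := Nat.le_floor (by rw [Nat.cast_one]; exact Real.one_le_sqrt.2 hX1)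
  have hM1R : (1 : ℝ) ≤ M := by exact_mod_cast hM1
  have hMX : (M : ℝ) ^ 2 ≤ X := by
    have h := Nat.floor_le (Real.sqrt_nonneg X)
    calc (M : ℝ) ^ 2 ≤ √X ^ 2 := by gcongr
      _ = X := Real.sq_sqrt hX0.le
  have hXM : X < ((M : ℝ) + 1) ^ 2 := by
    have h := Nat.lt_floor_add_one (√X)
    calc X = √X ^ 2 := (Real.sq_sqrt hX0.le).symm
      _ < _ := by gcongr
  have hKM : K ≤ M := by
    have : K < M + 1 := by
      rw [hK, Nat.floor_lt (by positivity), div_lt_iff₀ (by positivity)]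
      push_cast
      linarith [sq ((M : ℝ) + 1)]
    omega
  have hKX : (K : ℝ) ^ 2 ≤ X := by
    refine le_trans ?_ hMX
    gcongr
  have hML : M ≤ ⌊X⌋₊ := Nat.le_floor (by nlinarith)
  rw [← hX]
  rw [← sum_Ioc_consecutive _ (Nat.zero_le M) hML]
  have A1 : ∑ b ∈ Ioc 0 M, ((⌊X / b⌋₊ : ℝ) - ⌊X / (b + ρ)⌋₊ - (X / b - X / (b + ρ)))
      = ∑ b ∈ Ioc 0 M, sawtooth (X / (b + ρ) + 0) - ∑ b ∈ Ioc 0 M, sawtooth (X / (b + 0) + 0) := by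
    rw [← sum_sub_distrib]
    refine sum_congr rfl fun b _ => ?_
    rw [natCast_floor_eq_sub_sawtooth (by positivity),
      natCast_floor_eq_sub_sawtooth (by positivity)]
    simp only [add_zero]
    ring
  have A2 : ∑ b ∈ Ioc M ⌊X⌋₊, ((⌊X / b⌋₊ : ℝ) - ⌊X / (b + ρ)⌋₊ - (X / b - X / (b + ρ)))
      = (∑ n ∈ Ioc 0 K, sawtooth (X / (n + 0) + (-ρ)) - ∑ n ∈ Ioc 0 K, sawtooth (X / (n + 0) + 0))
        + (K * ρ - X * ∑ b ∈ Ioc M ⌊X⌋₊, (1 / (b : ℝ) - 1 / (b + ρ))) := by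
    have h0 := sum_Ioc_floor_div_add hX0.le le_rfl zero_le_one M
    have h1 := sum_Ioc_floor_div_add hX0.le hρ0 hρ1 M
    simp only [add_zero, sub_zero] at h0
    rw [sum_sub_distrib, sum_sub_distrib, h0, h1, ← hK, ← sum_sub_distrib, ← sum_sub_distrib]
    have h2 : ∑ n ∈ Ioc 0 K, ((⌊X / n⌋₊ : ℝ) - M - ((⌊X / n - ρ⌋₊ : ℝ) - M))
        = ∑ n ∈ Ioc 0 K, (sawtooth (X / (n + 0) + (-ρ)) - sawtooth (X / (n + 0) + 0) + ρ) := by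
      refine sum_congr rfl fun n hn => ?_
      rw [mem_Ioc] at hn
      have hn0 : (0 : ℝ) < n := by exact_mod_cast hn.1
      have h3 : (n : ℝ) ≤ X / (M + 1) := (Nat.le_floor_iff (by positivity)).1 hn.2
      have h4 : (M : ℝ) + 1 ≤ X / n := by
        rw [le_div_iff₀ (by positivity)] at h3 ⊢
        linarith
      rw [natCast_floor_eq_sub_sawtooth (by linarith : 0 ≤ X / (n : ℝ)),
        natCast_floor_eq_sub_sawtooth (by linarith : 0 ≤ X / (n : ℝ) - ρ)]
      simp only [add_zero, ← sub_eq_add_neg]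
      ring
    rw [h2, sum_add_distrib, mul_sum]
    have h5 : ∑ b ∈ Ioc M ⌊X⌋₊, (X / (b : ℝ) - X / (b + ρ))
        = ∑ b ∈ Ioc M ⌊X⌋₊, X * (1 / (b : ℝ) - 1 / (b + ρ)) :=
      sum_congr rfl fun b _ => by ring
    rw [h5]
    simp
    ring
  have B1 := abs_le.1 (abs_sum_Ioc_sawtooth_le hY 0 hρ0 hρ1 (hX ▸ hMX))
  have B2 := abs_le.1 (abs_sum_Ioc_sawtooth_le hY 0 le_rfl zero_le_one (hX ▸ hMX))
  have B3 := abs_le.1 (abs_sum_Ioc_sawtooth_le hY (-ρ) le_rfl zero_le_one (hX ▸ hKX))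
  have B4 := abs_le.1 (abs_sum_Ioc_sawtooth_le hY 0 le_rfl zero_le_one (hX ▸ hKX))
  rw [← hX] at B1 B2 B3 B4
  have B5 : |K * ρ - X * ∑ b ∈ Ioc M ⌊X⌋₊, (1 / (b : ℝ) - 1 / (b + ρ))| ≤ 4 := by
    obtain ⟨h1, h2⟩ := sum_Ioc_inv_sub_inv_add_bounds hρ0 hρ1 hM1 hML
    have h1' := mul_le_mul_of_nonneg_left h1 hX0.le
    have h2' := mul_le_mul_of_nonneg_left h2 hX0.le
    have hK1 : (K : ℝ) ≤ X / (M + 1) := Nat.floor_le (by positivity)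
    have hK2 : X / (M + 1) < K + 1 := Nat.lt_floor_add_one _
    have hL : X / ((⌊X⌋₊ : ℝ) + 1) ≤ 1 := by
      rw [div_le_one (by positivity)]; exact (Nat.lt_floor_add_one X).le
    have hL0 : 0 ≤ X / (⌊X⌋₊ : ℝ) := by positivity
    have hd : X / M - X / (M + 1) ≤ 2 := by
      rw [show X / (M : ℝ) - X / (M + 1) = X / (M * (M + 1)) by field_simp; ring,
        div_le_iff₀ (by positivity)]
      nlinarith
    have e1 : X * (ρ * (1 / ((M : ℝ) + 1) - 1 / (⌊X⌋₊ + 1)))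
        = ρ * (X / (M + 1) - X / (⌊X⌋₊ + 1)) := by ring
    have e2 : X * (ρ * (1 / (M : ℝ) - 1 / ⌊X⌋₊)) = ρ * (X / M - X / ⌊X⌋₊) := by ring
    rw [e1] at h1'
    rw [e2] at h2'
    rw [abs_le]
    constructor
    · have : ρ * (X / M - X / ⌊X⌋₊ - K) ≤ ρ * 3 := by gcongr; linarith
      rw [mul_sub] at this
      linarith
    · have : ρ * (K - (X / (M + 1) - X / (⌊X⌋₊ + 1))) ≤ ρ * 1 := by gcongr; linarith
      rw [mul_sub] at this
      linarith
  have B6 := abs_le.1 B5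
  rw [A1, A2, abs_le]
  have h8 : 1 ≤ Y * (1 + Real.log Y) ^ 2 := by
    nlinarith [mul_nonneg hY0.le hlog, mul_nonneg hlog hlog,
      mul_nonneg hY0.le (mul_nonneg hlog hlog)]
  constructor <;> linarith [B1.1, B1.2, B2.1, B2.2, B3.1, B3.2, B4.1, B4.2, B6.1, B6.2]

theorem exists_card_divisors_le_rpow {ε : ℝ} (hε : 0 < ε) :
    ∃ C : ℝ, 0 ≤ C ∧ ∀ n : ℕ, 0 < n → (n.divisors.card : ℝ) ≤ C * (n : ℝ) ^ ε := by
  have hlog2 : 0 < Real.log 2 := Real.log_pos one_lt_two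
  set D : ℝ := 1 + 1 / (ε * Real.log 2) with hD
  have hD1 : 1 ≤ D := by
    have : 0 ≤ 1 / (ε * Real.log 2) := by positivity
    linarith
  set P : ℕ := ⌈(2 : ℝ) ^ (1 / ε)⌉₊ with hP
  refine ⟨D ^ P, by positivity, fun n hn => ?_⟩
  have hfac : ((n : ℝ)) ^ ε = ∏ p ∈ n.primeFactors, ((p : ℝ) ^ n.factorization p) ^ ε := by
    rw [Real.finsetProd_rpow _ _ (fun p _ => by positivity)]
    congr 1
    exact_mod_cast (Nat.prod_factorization_pow_eq_self hn.ne').symm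
  have hterm : ∀ p ∈ n.primeFactors, ((n.factorization p + 1 : ℕ) : ℝ)
      ≤ (if p < P then D else 1) * ((p : ℝ) ^ n.factorization p) ^ ε := by
    intro p hp
    have hp2 : (2 : ℝ) ≤ p := by exact_mod_cast (Nat.prime_of_mem_primeFactors hp).two_le
    set k := n.factorization p
    have e : ((p : ℝ) ^ k) ^ ε = ((p : ℝ) ^ ε) ^ k := by
      rw [← Real.rpow_natCast, ← Real.rpow_mul (by positivity), mul_comm,
        Real.rpow_mul (by positivity),
        Real.rpow_natCast]
    split_ifs with h
    · have h1 : 1 + k * (ε * Real.log 2) ≤ ((p : ℝ) ^ k) ^ ε := by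
        calc 1 + k * (ε * Real.log 2) ≤ Real.exp (k * (ε * Real.log 2)) := by
              linarith [Real.add_one_le_exp (k * (ε * Real.log 2))]
          _ = ((2 : ℝ) ^ k) ^ ε := by
              rw [Real.rpow_def_of_pos (by positivity), Real.log_pow]; ring_nf
          _ ≤ _ := by gcongr
      calc ((k + 1 : ℕ) : ℝ) ≤ D * (1 + k * (ε * Real.log 2)) := by
            have : D * (1 + k * (ε * Real.log 2))
              = 1 + k + k * (ε * Real.log 2) + 1 / (ε * Real.log 2) := by
              rw [hD]; field_simp; ring
            rw [this]
            have : 0 ≤ k * (ε * Real.log 2) + 1 / (ε * Real.log 2) := by positivity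
            push_cast
            linarith
        _ ≤ _ := by gcongr
    · have h2 : (2 : ℝ) ≤ (p : ℝ) ^ ε := by
        have h3 : (2 : ℝ) ^ (1 / ε) ≤ p := (Nat.le_ceil _).trans (by exact_mod_cast not_lt.1 h)
        calc (2 : ℝ) = ((2 : ℝ) ^ (1 / ε)) ^ ε := by
              rw [← Real.rpow_mul (by norm_num), one_div_mul_cancel hε.ne', Real.rpow_one]
          _ ≤ _ := by gcongr
      rw [one_mul, e]
      calc ((k + 1 : ℕ) : ℝ) ≤ (2 : ℝ) ^ k := by exact_mod_cast Nat.lt_two_pow_self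
        _ ≤ _ := by gcongr
  rw [Nat.card_divisors hn.ne', hfac]
  push_cast
  calc _ ≤ ∏ p ∈ n.primeFactors, (if p < P then D else 1) * ((p : ℝ) ^ n.factorization p) ^ ε :=
        prod_le_prod (fun p _ => by positivity) fun p hp => by exact_mod_cast hterm p hp
    _ = (∏ p ∈ n.primeFactors, if p < P then D else 1) *
          ∏ p ∈ n.primeFactors, ((p : ℝ) ^ n.factorization p) ^ ε := prod_mul_distrib
    _ ≤ _ := by
      gcongr
      rw [← prod_filter, prod_const]
      refine pow_le_pow_right₀ hD1 ?_
      calc _ ≤ (range P).card := card_le_card (by intro p; simp)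
        _ = P := card_range P

theorem sq_dvd_sq_mul_iff_of_squarefree {a b s : ℕ} (hs : Squarefree s) :
    a ^ 2 ∣ b ^ 2 * s ↔ a ∣ b := by
  constructor
  · intro h
    rcases Nat.eq_zero_or_pos (Nat.gcd a b) with h0 | h0
    · rw [(Nat.gcd_eq_zero_iff.1 h0).2]; exact dvd_zero a
    obtain ⟨a', b', hcop, ha, hb⟩ := Nat.exists_coprime a b
    set g := Nat.gcd a b
    rw [ha, hb] at h
    have h1 : a' ^ 2 ∣ b' ^ 2 * s := by
      have : g ^ 2 * a' ^ 2 ∣ g ^ 2 * (b' ^ 2 * s) := by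
        convert h using 1 <;> ring
      exact Nat.dvd_of_mul_dvd_mul_left (by positivity) this
    have h2 : a' ^ 2 ∣ s := (Nat.Coprime.pow 2 2 hcop).dvd_of_dvd_mul_left h1
    have h3 : a' = 1 := Nat.isUnit_iff.1 (hs a' (by rwa [← sq]))
    rw [ha, hb, h3, one_mul]
    exact dvd_mul_left g b'
  · intro h
    exact (pow_dvd_pow_of_dvd h 2).mul_right s

theorem muk_two_eq_ite (n : ℕ) [Decidable (Squarefree n)] :
    muk 2 n = if Squarefree n then 1 else 0 := by
  have h : Squarefree n ↔ ∀ p : ℕ, p.Prime → ¬ p ^ 2 ∣ n := by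
    simp only [Nat.squarefree_iff_prime_squarefree, sq]
  unfold muk
  by_cases hn : Squarefree n
  · rw [if_pos hn, if_pos (h.1 hn)]
  · rw [if_neg hn, if_neg (mt h.2 hn)]

theorem muk_two_nonneg (n : ℕ) : 0 ≤ muk 2 n := by
  classical
  rw [muk_two_eq_ite]; split_ifs <;> norm_num

theorem muk_two_le_one (n : ℕ) : muk 2 n ≤ 1 := by
  classical
  rw [muk_two_eq_ite]; split_ifs <;> norm_num

theorem muk_two_eq_sum_moebius {n N : ℕ} (hn : 0 < n) (hN : n ≤ N) :
    muk 2 n = ∑ a ∈ Ioc 0 N, if a ^ 2 ∣ n then (ArithmeticFunction.moebius a : ℝ) else 0 := by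
  classical
  obtain ⟨s, b, hs0, hb0, hsb, hs⟩ := Nat.sq_mul_squarefree_of_pos hn
  have h1 : (Ioc 0 N).filter (fun a => a ^ 2 ∣ n) = b.divisors := by
    ext a
    rw [mem_filter, Nat.mem_divisors, mem_Ioc, ← hsb, sq_dvd_sq_mul_iff_of_squarefree hs]
    constructor
    · rintro ⟨-, h⟩; exact ⟨h, hb0.ne'⟩
    · rintro ⟨h, -⟩
      have h2 := Nat.le_of_dvd hb0 h
      have h3 := Nat.pos_of_dvd_of_pos h hb0
      have h4 : b ≤ n := by rw [← hsb]; nlinarith [Nat.mul_le_mul hb0 hs0]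
      exact ⟨⟨h3, by omega⟩, h⟩
  rw [← sum_filter, h1]
  have h2 : ∑ a ∈ b.divisors, ArithmeticFunction.moebius a = if b = 1 then 1 else 0 := by
    rw [← ArithmeticFunction.coe_mul_zeta_apply, ArithmeticFunction.moebius_mul_coe_zeta,
      ArithmeticFunction.one_apply]
  have h3 : Squarefree n ↔ b = 1 := by
    constructor
    · intro h
      exact Nat.isUnit_iff.1 (h b ⟨s, by rw [← hsb]; ring⟩)
    · rintro rfl
      rw [← hsb]; simpa using hs
  rw [muk_two_eq_ite, ← Int.cast_sum, h2]
  simp only [h3]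
  split_ifs <;> simp

theorem sum_Ioc_ite_dvd_eq {m : ℕ} (hm : 0 < m) (N : ℕ) (g : ℕ → ℝ) :
    (∑ d ∈ Ioc 0 N, if m ∣ d then g d else 0) = ∑ b ∈ Ioc 0 (N / m), g (m * b) := by
  rw [← sum_filter]
  symm
  refine sum_nbij (fun b => m * b) ?_ ?_ ?_ (fun _ _ => rfl)
  · intro b hb
    rw [mem_Ioc, Nat.le_div_iff_mul_le hm] at hb
    rw [mem_filter, mem_Ioc]
    exact ⟨⟨Nat.mul_pos hm hb.1, by rw [mul_comm]; exact hb.2⟩, dvd_mul_right m b⟩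
  · intro b _ b' _ h
    exact Nat.eq_of_mul_eq_mul_left hm h
  · intro d hd
    simp only [coe_filter, mem_Ioc, Set.mem_ofPred_eq] at hd
    obtain ⟨⟨h1, h2⟩, b, rfl⟩ := hd
    refine ⟨b, ?_, rfl⟩
    rw [mem_coe, mem_Ioc, Nat.le_div_iff_mul_le hm, mul_comm]
    exact ⟨Nat.pos_of_mul_pos_left h1, h2⟩

theorem sum_Ioc_muk_two_mul (N : ℕ) (g : ℕ → ℝ) :
    ∑ d ∈ Ioc 0 N, muk 2 d * g d = ∑ a ∈ Ioc 0 N,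
      (ArithmeticFunction.moebius a : ℝ) * ∑ b ∈ Ioc 0 (N / a ^ 2), g (a ^ 2 * b) := by
  have h1 : ∀ d ∈ Ioc 0 N, muk 2 d * g d = ∑ a ∈ Ioc 0 N,
      (ArithmeticFunction.moebius a : ℝ) * (if a ^ 2 ∣ d then g d else 0) := by
    intro d hd
    rw [mem_Ioc] at hd
    rw [muk_two_eq_sum_moebius hd.1 hd.2, sum_mul]
    refine sum_congr rfl fun a _ => ?_
    split_ifs <;> simp
  rw [sum_congr rfl h1, sum_comm]
  refine sum_congr rfl fun a ha => ?_
  rw [mem_Ioc] at ha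
  rw [← mul_sum, sum_Ioc_ite_dvd_eq (by have := ha.1; positivity)]

theorem floor_div_eq_iff {x : ℝ} (hx : 0 ≤ x) {n d : ℕ} (hn : 0 < n) (hd : 0 < d) :
    ⌊x / n⌋₊ = d ↔ n ∈ Ioc ⌊x / (d + 1)⌋₊ ⌊x / d⌋₊ := by
  have hn' : (0 : ℝ) < n := by exact_mod_cast hn
  have hd' : (0 : ℝ) < d := by exact_mod_cast hd
  rw [Nat.floor_eq_iff (by positivity), mem_Ioc, Nat.floor_lt (by positivity),
    Nat.le_floor_iff (by positivity), le_div_iff₀ hn', div_lt_iff₀ hn', le_div_iff₀ hd',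
    div_lt_iff₀ (by positivity), mul_comm (d : ℝ), mul_comm (n : ℝ) ((d : ℝ) + 1)]
  tauto

theorem filter_floor_div_eq {x : ℝ} (hx : 0 ≤ x) {d : ℕ} (hd : 0 < d) :
    (Icc 1 ⌊x⌋₊).filter (fun n : ℕ => ⌊x / (n : ℝ)⌋₊ = d)
      = Ioc ⌊x / ((d : ℝ) + 1)⌋₊ ⌊x / (d : ℝ)⌋₊ := by
  have hd1 : (1 : ℝ) ≤ d := by exact_mod_cast hd
  ext n
  rw [mem_filter, mem_Icc]
  constructor
  · rintro ⟨h, h'⟩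
    exact (floor_div_eq_iff hx h.1 hd).1 h'
  · intro h
    have h2 := mem_Ioc.1 h
    have h3 : 0 < n := by omega
    exact ⟨⟨h3, h2.2.trans (Nat.floor_le_floor (div_le_self hx hd1))⟩,
      (floor_div_eq_iff hx h3 hd).2 h⟩

theorem card_filter_floor_div_eq {x : ℝ} (hx : 0 ≤ x) {d : ℕ} (hd : 0 < d) :
    (((Icc 1 ⌊x⌋₊).filter (fun n : ℕ => ⌊x / (n : ℝ)⌋₊ = d)).card : ℝ)
      = (⌊x / (d : ℝ)⌋₊ : ℝ) - ⌊x / ((d : ℝ) + 1)⌋₊ := by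
  rw [filter_floor_div_eq hx hd, Nat.card_Ioc, Nat.cast_sub]
  refine Nat.floor_le_floor ?_
  have : (0 : ℝ) < d := by exact_mod_cast hd
  gcongr
  linarith

theorem sum_floor_div_eq {x : ℝ} (hx : 0 ≤ x) (f : ℕ → ℝ) :
    ∑ n ∈ Icc 1 ⌊x⌋₊, f ⌊x / (n : ℝ)⌋₊
      = ∑ d ∈ Ioc 0 ⌊x⌋₊, f d * ((⌊x / (d : ℝ)⌋₊ : ℝ) - ⌊x / ((d : ℝ) + 1)⌋₊) := by
  have hmaps : ∀ n ∈ Icc 1 ⌊x⌋₊, ⌊x / (n : ℝ)⌋₊ ∈ Ioc 0 ⌊x⌋₊ := by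
    intro n hn
    rw [mem_Icc] at hn
    have hn1 : (1 : ℝ) ≤ n := by exact_mod_cast hn.1
    have hnx : (n : ℝ) ≤ x := (Nat.le_floor_iff hx).1 hn.2
    rw [mem_Ioc]
    refine ⟨Nat.floor_pos.2 ?_, Nat.floor_le_floor (div_le_self hx hn1)⟩
    rw [le_div_iff₀ (by linarith)]; linarith
  rw [← sum_fiberwise_of_maps_to hmaps]
  refine sum_congr rfl fun d hd => ?_
  rw [mem_Ioc] at hd
  have h4 : ∀ n ∈ (Icc 1 ⌊x⌋₊).filter (fun n : ℕ => ⌊x / (n : ℝ)⌋₊ = d),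
      f ⌊x / (n : ℝ)⌋₊ = f d := fun n hn => by rw [(mem_filter.1 hn).2]
  rw [sum_congr rfl h4, sum_const, nsmul_eq_mul, card_filter_floor_div_eq hx hd.1, mul_comm]

theorem abs_tsum_muk_two_sub_le (N : ℕ) :
    |(∑' n : ℕ, muk 2 (n + 1) / (((n : ℝ) + 1) * ((n : ℝ) + 2)))
      - ∑ d ∈ Ioc 0 N, muk 2 d * (1 / (d : ℝ) - 1 / (d + 1))| ≤ 1 / (N + 1) := by
  set f : ℕ → ℝ := fun n => muk 2 (n + 1) / (((n : ℝ) + 1) * ((n : ℝ) + 2)) with hf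
  have hf0 : ∀ n, 0 ≤ f n := fun n => div_nonneg (muk_two_nonneg _) (by positivity)
  have hfeq : ∀ n : ℕ, f n = muk 2 (n + 1) * (1 / ((n : ℝ) + 1) - 1 / (n + 2)) := by
    intro n
    simp only [hf]
    field_simp
    ring
  have hfle : ∀ n : ℕ, f n ≤ 1 / ((n : ℝ) + 1) - 1 / (n + 2) := by
    intro n
    rw [hfeq]
    have : 0 ≤ 1 / ((n : ℝ) + 1) - 1 / (n + 2) := by
      rw [sub_nonneg]; gcongr; linarith
    nlinarith [muk_two_le_one (n + 1)]
  have hpart : ∀ K n : ℕ, ∑ i ∈ range n, f (i + K) ≤ 1 / ((K : ℝ) + 1) - 1 / (n + K + 1) := by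
    intro K n
    induction n with
    | zero => simp
    | succ n ih =>
      rw [sum_range_succ]
      have := hfle (n + K)
      push_cast at this ⊢
      have e : (n : ℝ) + 1 + K + 1 = n + K + 2 := by ring
      rw [e]
      linarith
  have hpart' : ∀ K n : ℕ, ∑ i ∈ range n, f (i + K) ≤ 1 / ((K : ℝ) + 1) := fun K n =>
    (hpart K n).trans (sub_le_self _ (by positivity))
  have hsum : Summable f := summable_of_sum_range_le hf0 (c := 1 / (((0 : ℕ) : ℝ) + 1))
    (fun n => by simpa using hpart' 0 n)
  have hsplit := hsum.sum_add_tsum_nat_add N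
  have hIoc : ∑ d ∈ Ioc 0 N, muk 2 d * (1 / (d : ℝ) - 1 / (d + 1)) = ∑ n ∈ range N, f n := by
    have : Ioc 0 N = Ico (0 + 1) (N + 1) := by ext; simp; omega
    rw [this, ← sum_Ico_add' (fun d : ℕ => muk 2 d * (1 / (d : ℝ) - 1 / (d + 1))),
      ← range_eq_Ico]
    refine sum_congr rfl fun n _ => ?_
    rw [hfeq]
    push_cast
    ring_nf
  rw [hIoc, ← hsplit, add_sub_cancel_left, abs_of_nonneg (tsum_nonneg fun n => hf0 _)]
  exact Real.tsum_le_of_sum_range_le (fun n => hf0 _) (hpart' N)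

/-- The difference between the number of `n` with `⌊x / n⌋ = d` and its expected value. -/
noncomputable def floorError (x : ℝ) (d : ℕ) : ℝ :=
  (⌊x / (d : ℝ)⌋₊ : ℝ) - ⌊x / ((d : ℝ) + 1)⌋₊ - (x / d - x / (d + 1))

theorem abs_floorError_le_one {x : ℝ} (hx : 0 ≤ x) (d : ℕ) : |floorError x d| ≤ 1 := by
  have h1 := Nat.floor_le (show 0 ≤ x / (d : ℝ) by positivity)
  have h2 := Nat.lt_floor_add_one (x / (d : ℝ))
  have h3 := Nat.floor_le (show 0 ≤ x / ((d : ℝ) + 1) by positivity)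
  have h4 := Nat.lt_floor_add_one (x / ((d : ℝ) + 1))
  unfold floorError
  rw [abs_le]
  constructor <;> linarith

theorem abs_sum_floorError_sq_mul_le {x : ℝ} (hx : 1 ≤ x) {a : ℕ} (ha : 0 < a) :
    |∑ b ∈ Ioc 0 (⌊x⌋₊ / a ^ 2), floorError x (a ^ 2 * b)|
      ≤ 200000 * (x ^ (1 / 3 : ℝ) * (a : ℝ) ^ (-(2 / 3) : ℝ)) * (1 + Real.log x) ^ 2 := by
  have ha1 : (1 : ℝ) ≤ a := by exact_mod_cast ha
  have ha2 : (1 : ℝ) ≤ (a : ℝ) ^ 2 := one_le_pow₀ ha1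
  have hlog : 0 ≤ Real.log x := Real.log_nonneg hx
  have hfl : ⌊x⌋₊ / a ^ 2 = ⌊x / (a : ℝ) ^ 2⌋₊ := by
    rw [← Nat.floor_div_natCast]; push_cast; rfl
  rcases lt_or_ge x ((a : ℝ) ^ 2) with hlt | hge
  · have : ⌊x / (a : ℝ) ^ 2⌋₊ = 0 := by
      rw [Nat.floor_eq_zero, div_lt_one (by positivity)]; exact hlt
    rw [hfl, this, Ioc_self, sum_empty, abs_zero]
    positivity
  set X := x / (a : ℝ) ^ 2 with hX
  have hX1 : 1 ≤ X := by rw [hX, le_div_iff₀ (by positivity)]; linarith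
  have hXx : X ≤ x := div_le_self (by linarith) ha2
  set Y := X ^ (1 / 3 : ℝ) with hYdef
  have hY1 : 1 ≤ Y := Real.one_le_rpow hX1 (by norm_num)
  have hY3 : Y ^ 3 = X := by
    rw [hYdef, ← Real.rpow_natCast, ← Real.rpow_mul (by linarith)]; norm_num
  have hYx : Y ≤ x := by
    refine le_trans ?_ hXx
    rw [← hY3]; exact le_self_pow₀ hY1 (by norm_num)
  have hYeq : Y = x ^ (1 / 3 : ℝ) * (a : ℝ) ^ (-(2 / 3) : ℝ) := by
    rw [hYdef, hX, Real.div_rpow (by linarith) (by positivity), div_eq_mul_inv, Real.rpow_neg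
      (by positivity), ← Real.rpow_natCast (a : ℝ) 2, ← Real.rpow_mul (by positivity)]
    norm_num
  have key := abs_sum_floor_div_sub_floor_div_add_le hY1
    (show 0 ≤ 1 / (a : ℝ) ^ 2 by positivity)
    (show 1 / (a : ℝ) ^ 2 ≤ 1 by rw [div_le_one (by positivity)]; exact ha2)
  rw [hY3] at key
  rw [hfl, ← hYeq]
  have hcongr : ∑ b ∈ Ioc 0 ⌊X⌋₊, floorError x (a ^ 2 * b)
      = ∑ b ∈ Ioc 0 ⌊X⌋₊, ((⌊X / (b : ℝ)⌋₊ : ℝ) - ⌊X / ((b : ℝ) + 1 / (a : ℝ) ^ 2)⌋₊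
        - (X / b - X / (b + 1 / (a : ℝ) ^ 2))) := by
    refine sum_congr rfl fun b hb => ?_
    have hb0 : (0 : ℝ) < b := by exact_mod_cast (mem_Ioc.1 hb).1
    have e1 : x / (((a ^ 2 * b : ℕ)) : ℝ) = X / b := by
      rw [hX]; push_cast; field_simp
    have e2 : x / (((a ^ 2 * b : ℕ) : ℝ) + 1) = X / ((b : ℝ) + 1 / (a : ℝ) ^ 2) := by
      rw [hX]; push_cast; field_simp
    rw [floorError, e1, e2]
  rw [hcongr]
  refine key.trans ?_
  have hlogY : 0 ≤ Real.log Y := Real.log_nonneg hY1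
  gcongr

theorem sum_Ioc_rpow_neg_two_thirds_le (n : ℕ) :
    ∑ a ∈ Ioc 0 n, (a : ℝ) ^ (-(2 / 3) : ℝ) ≤ 3 * (n : ℝ) ^ (1 / 3 : ℝ) := by
  induction n with
  | zero => simp
  | succ n ih =>
    rw [← Finset.insert_Ioc_right_eq_Ioc_add_one (Nat.zero_le n), sum_insert (by simp)]
    set p := ((n + 1 : ℕ) : ℝ) ^ (1 / 3 : ℝ) with hp
    set q := (n : ℝ) ^ (1 / 3 : ℝ) with hq
    have hp0 : 0 < p := by positivity
    have hq0 : 0 ≤ q := by positivity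
    have hp3 : p ^ 3 = n + 1 := by
      rw [hp, ← Real.rpow_natCast, ← Real.rpow_mul (by positivity)]; norm_num
    have hq3 : q ^ 3 = n := by
      rw [hq, ← Real.rpow_natCast, ← Real.rpow_mul (by positivity)]; norm_num
    have hqp : q ≤ p := by rw [hp, hq]; gcongr; simp
    have h1 : ((n + 1 : ℕ) : ℝ) ^ (-(2 / 3) : ℝ) = 1 / p ^ 2 := by
      rw [hp, ← Real.rpow_natCast, ← Real.rpow_mul (by positivity), Real.rpow_neg (by positivity)]
      norm_num
    have h2 : 1 / p ^ 2 ≤ 3 * (p - q) := by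
      rw [div_le_iff₀ (by positivity)]
      have : 1 = (p - q) * (p ^ 2 + p * q + q ^ 2) := by linear_combination hq3 - hp3
      have h3 : p ^ 2 + p * q + q ^ 2 ≤ 3 * p ^ 2 := by nlinarith
      nlinarith [mul_le_mul_of_nonneg_left h3 (sub_nonneg.2 hqp)]
    rw [h1]
    linarith

theorem sum_Ioc_inv_sq_le_div {z : ℝ} (hz : 0 < z) (M : ℕ) :
    ∑ b ∈ Ioc ⌊z⌋₊ M, ((b : ℝ) ^ 2)⁻¹ ≤ 2 / z := by
  have h := sum_Ioo_inv_sq_le (α := ℝ) ⌊z⌋₊ (M + 1)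
  have e : Ioo ⌊z⌋₊ (M + 1) = Ioc ⌊z⌋₊ M := by ext; simp
  rw [e] at h
  refine h.trans ?_
  have := Nat.lt_floor_add_one z
  gcongr

theorem sum_Ioc_inv_cube_le_div {z : ℝ} (hz : 0 < z) (M : ℕ) :
    ∑ b ∈ Ioc ⌊z⌋₊ M, 1 / (b : ℝ) ^ 3 ≤ 2 / z ^ 2 := by
  have h : ∀ b ∈ Ioc ⌊z⌋₊ M, 1 / (b : ℝ) ^ 3 ≤ 1 / z * ((b : ℝ) ^ 2)⁻¹ := by
    intro b hb
    have h1 : z < b := (Nat.floor_lt hz.le).1 (mem_Ioc.1 hb).1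
    have hb0 : (0 : ℝ) < b := hz.trans h1
    have e : 1 / (b : ℝ) ^ 3 = 1 / b * ((b : ℝ) ^ 2)⁻¹ := by field_simp
    rw [e]
    gcongr
  refine (sum_le_sum h).trans ?_
  rw [← mul_sum]
  calc 1 / z * ∑ b ∈ Ioc ⌊z⌋₊ M, ((b : ℝ) ^ 2)⁻¹ ≤ 1 / z * (2 / z) := by
        gcongr; exact sum_Ioc_inv_sq_le_div hz M
    _ = 2 / z ^ 2 := by field_simp

theorem sum_Ioc_inv_le_one_add_log {z : ℝ} (hz : 1 ≤ z) (k : ℕ) :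
    ∑ a ∈ Ioc k ⌊z⌋₊, 1 / (a : ℝ) ≤ 1 + Real.log z := by
  have h0 : 0 < ⌊z⌋₊ := Nat.floor_pos.2 hz
  have h1 : Ioc k ⌊z⌋₊ ⊆ Icc 1 ⌊z⌋₊ := by
    intro a; simp only [mem_Ioc, mem_Icc]; omega
  refine (sum_le_sum_of_subset_of_nonneg h1 fun _ _ _ => by positivity).trans
    ((sum_Icc_inv_le_one_add_log _).trans ?_)
  have h2 : (⌊z⌋₊ : ℝ) ≤ z := Nat.floor_le (by linarith)
  have h3 : (0 : ℝ) < ⌊z⌋₊ := by exact_mod_cast h0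
  gcongr

theorem abs_sum_floorError_sq_mul_le_of_split {x H : ℝ} (hx : 0 ≤ x) (hH : 0 < H) {a : ℕ}
    (ha : 0 < a) (M : ℕ) :
    |∑ b ∈ Ioc 0 M, floorError x (a ^ 2 * b)| ≤ H * (1 / a) + 2 * x / H * (1 / (a : ℝ) ^ 3) +
      ∑ b ∈ Ioc ⌊H / a⌋₊ M,
        (((Icc 1 ⌊x⌋₊).filter (fun n : ℕ => ⌊x / (n : ℝ)⌋₊ = a ^ 2 * b)).card : ℝ) := by
  have ha0 : (0 : ℝ) < a := by exact_mod_cast ha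
  set K := ⌊H / a⌋₊ with hK
  have hsub : Ioc 0 M ⊆ Ioc 0 K ∪ Ioc K M := by
    intro b; simp only [mem_union, mem_Ioc]; omega
  have hdisj : Disjoint (Ioc 0 K) (Ioc K M) := by
    rw [Finset.disjoint_left]; intro b; simp only [mem_Ioc]; omega
  have h1 : ∑ b ∈ Ioc 0 K, |floorError x (a ^ 2 * b)| ≤ H * (1 / a) := by
    refine (sum_le_sum fun b _ => abs_floorError_le_one hx _).trans ?_
    rw [sum_const, Nat.card_Ioc, nsmul_eq_mul, mul_one, Nat.sub_zero, mul_one_div]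
    exact Nat.floor_le (by positivity)
  have h2 : ∀ b ∈ Ioc K M, |floorError x (a ^ 2 * b)| ≤
      x / (a : ℝ) ^ 4 * ((b : ℝ) ^ 2)⁻¹ +
      (((Icc 1 ⌊x⌋₊).filter (fun n : ℕ => ⌊x / (n : ℝ)⌋₊ = a ^ 2 * b)).card : ℝ) := by
    intro b hb
    have hb1 : 0 < b := (Nat.zero_le _).trans_lt (mem_Ioc.1 hb).1
    have hb0 : (0 : ℝ) < b := by exact_mod_cast hb1
    have h3 := card_filter_floor_div_eq hx (d := a ^ 2 * b) (by positivity)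
    rw [floorError, ← h3]
    have h4 : x / ((a ^ 2 * b : ℕ) : ℝ) - x / (((a ^ 2 * b : ℕ) : ℝ) + 1)
        = x / (((a : ℝ) ^ 2 * b) * ((a : ℝ) ^ 2 * b + 1)) := by
      push_cast; field_simp; ring
    have h5 : x / (((a : ℝ) ^ 2 * b) * ((a : ℝ) ^ 2 * b + 1))
        ≤ x / (a : ℝ) ^ 4 * ((b : ℝ) ^ 2)⁻¹ := by
      rw [← div_eq_mul_inv, div_div]
      have : (a : ℝ) ^ 4 * (b : ℝ) ^ 2 ≤ ((a : ℝ) ^ 2 * b) * ((a : ℝ) ^ 2 * b + 1) := by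
        nlinarith [show 0 < (a : ℝ) ^ 2 * b by positivity]
      gcongr
    have h6 : 0 ≤ x / (((a : ℝ) ^ 2 * b) * ((a : ℝ) ^ 2 * b + 1)) := by positivity
    rw [h4]
    refine (abs_sub _ _).trans ?_
    rw [abs_of_nonneg h6, abs_of_nonneg (by positivity)]
    linarith
  have h7 : x / (a : ℝ) ^ 4 * ∑ b ∈ Ioc K M, ((b : ℝ) ^ 2)⁻¹ ≤ 2 * x / H * (1 / (a : ℝ) ^ 3) := by
    calc _ ≤ x / (a : ℝ) ^ 4 * (2 / (H / a)) := by
          gcongr; exact sum_Ioc_inv_sq_le_div (by positivity) M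
      _ = _ := by field_simp
  calc |∑ b ∈ Ioc 0 M, floorError x (a ^ 2 * b)|
      ≤ ∑ b ∈ Ioc 0 M, |floorError x (a ^ 2 * b)| := abs_sum_le_sum_abs _ _
    _ ≤ ∑ b ∈ Ioc 0 K ∪ Ioc K M, |floorError x (a ^ 2 * b)| :=
        sum_le_sum_of_subset_of_nonneg hsub fun _ _ _ => abs_nonneg _
    _ ≤ _ := by
        rw [sum_union hdisj]
        have h8 := sum_le_sum h2
        rw [sum_add_distrib, ← mul_sum] at h8
        linarith

theorem sum_card_filter_floor_div_le {x H T : ℝ} (hx : 0 ≤ x) (hH : 0 < H)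
    (hT : ∀ m : ℕ, 0 < m → (m : ℝ) ≤ x → (m.divisors.card : ℝ) ≤ T) (hT0 : 0 ≤ T)
    {a : ℕ} (ha : 0 < a) (M : ℕ) :
    ∑ b ∈ Ioc ⌊H / a⌋₊ M,
        (((Icc 1 ⌊x⌋₊).filter (fun n : ℕ => ⌊x / (n : ℝ)⌋₊ = a ^ 2 * b)).card : ℝ)
      ≤ (1 + x / H * (1 / (a : ℝ) ^ 3)) * T := by
  have ha0 : (0 : ℝ) < a := by exact_mod_cast ha
  set L := x / H * (1 / (a : ℝ) ^ 3) with hL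
  have hL0 : 0 ≤ L := by positivity
  set β := x / (a : ℝ) ^ 2 with hβ
  have hβ0 : 0 ≤ β := by positivity
  set P := (Ioc ⌊H / a⌋₊ M).sigma
    (fun b => (Icc 1 ⌊x⌋₊).filter (fun n : ℕ => ⌊x / (n : ℝ)⌋₊ = a ^ 2 * b)) with hP
  have hcard : ∑ b ∈ Ioc ⌊H / a⌋₊ M,
      (((Icc 1 ⌊x⌋₊).filter (fun n : ℕ => ⌊x / (n : ℝ)⌋₊ = a ^ 2 * b)).card : ℝ) = P.card := by
    rw [hP, card_sigma]; push_cast; rfl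
  have hmem : ∀ q ∈ P, 0 < q.1 ∧ 0 < q.2 ∧ β - L < (q.2 : ℝ) * q.1 ∧ (q.2 : ℝ) * q.1 ≤ β := by
    rintro ⟨b, n⟩ hq
    simp only [hP, mem_sigma, mem_filter, mem_Ioc, mem_Icc] at hq
    obtain ⟨⟨hb, -⟩, ⟨hn, -⟩, hfl⟩ := hq
    have hb' : H / a < b := (Nat.floor_lt (by positivity)).1 hb
    have hn0 : (0 : ℝ) < n := by exact_mod_cast hn
    have hb0 : (0 : ℝ) < b := lt_of_le_of_lt (by positivity) hb'
    rw [Nat.floor_eq_iff (by positivity), le_div_iff₀ hn0, div_lt_iff₀ hn0] at hfl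
    push_cast at hfl
    obtain ⟨hf1, hf2⟩ := hfl
    have hup : (n : ℝ) * b ≤ β := by
      rw [hβ, le_div_iff₀ (by positivity)]; linarith
    have hab : H < a * b := by rw [div_lt_iff₀ ha0] at hb'; linarith
    have hnx : (n : ℝ) ≤ x / (a * H) := by
      rw [le_div_iff₀ (by positivity)]
      nlinarith [mul_le_mul_of_nonneg_left hab.le (show 0 ≤ (a : ℝ) * n by positivity)]
    have hlow : β < (n : ℝ) * b + n / (a : ℝ) ^ 2 := by
      rw [hβ, div_lt_iff₀ (by positivity), add_mul, div_mul_cancel₀ _ (by positivity)]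
      linarith
    have hnL : n / (a : ℝ) ^ 2 ≤ L := by
      have e : L = x / (a * H) / (a : ℝ) ^ 2 := by rw [hL]; field_simp
      rw [e]; gcongr
    refine ⟨by exact_mod_cast hb0, hn, ?_, hup⟩
    simp only
    linarith
  have hmaps : ∀ q ∈ P, q.2 * q.1 ∈ Ioc ⌊β - L⌋₊ ⌊β⌋₊ := by
    intro q hq
    obtain ⟨h1, h2, h3, h4⟩ := hmem q hq
    rw [mem_Ioc, Nat.floor_lt' (Nat.mul_pos h2 h1).ne', Nat.le_floor_iff hβ0]
    push_cast
    exact ⟨h3, h4⟩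
  have hfib : ∀ v ∈ Ioc ⌊β - L⌋₊ ⌊β⌋₊, ((P.filter fun q => q.2 * q.1 = v).card : ℝ) ≤ T := by
    intro v hv
    rw [mem_Ioc] at hv
    have hv0 : 0 < v := by omega
    have hvx : (v : ℝ) ≤ x := by
      refine ((Nat.le_floor_iff hβ0).1 hv.2).trans (div_le_self hx ?_)
      exact one_le_pow₀ (by exact_mod_cast ha)
    refine le_trans ?_ (hT v hv0 hvx)
    norm_cast
    refine card_le_card_of_injOn (fun q => q.2) ?_ ?_
    · intro q hq
      rw [mem_coe, mem_filter] at hq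
      rw [mem_coe, Nat.mem_divisors]
      exact ⟨⟨q.1, hq.2.symm⟩, hv0.ne'⟩
    · rintro ⟨b, n⟩ hq ⟨b', n'⟩ hq' h
      rw [mem_coe, mem_filter] at hq hq'
      simp only at h hq hq'
      subst h
      have h0 : 0 < n := (hmem _ hq.1).2.1
      have := Nat.eq_of_mul_eq_mul_left h0 (hq.2.trans hq'.2.symm)
      rw [this]
  have hcount : ((Ioc ⌊β - L⌋₊ ⌊β⌋₊).card : ℝ) ≤ 1 + L := by
    rw [Nat.card_Ioc, Nat.cast_sub (Nat.floor_le_floor (by linarith))]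
    have h1 := Nat.floor_le hβ0
    have h2 := Nat.lt_floor_add_one (β - L)
    linarith
  rw [hcard, card_eq_sum_card_fiberwise hmaps]
  push_cast
  refine (sum_le_sum hfib).trans ?_
  rw [sum_const, nsmul_eq_mul]
  gcongr

theorem sum_sum_card_filter_floor_div_le {x B T : ℝ} (hx : 0 ≤ x) (hB : 0 < B)
    (hT : ∀ m : ℕ, 0 < m → (m : ℝ) ≤ x → (m.divisors.card : ℝ) ≤ T) (hT0 : 0 ≤ T)
    (N : ℕ) (K M : ℕ → ℕ) :
    ∑ a ∈ Ioc ⌊B⌋₊ N, ∑ b ∈ Ioc (K a) (M a),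
        (((Icc 1 ⌊x⌋₊).filter (fun n : ℕ => ⌊x / (n : ℝ)⌋₊ = a ^ 2 * b)).card : ℝ)
      ≤ x / B ^ 2 * T := by
  set P := (Ioc ⌊B⌋₊ N).sigma fun a => (Ioc (K a) (M a)).sigma
    (fun b => (Icc 1 ⌊x⌋₊).filter (fun n : ℕ => ⌊x / (n : ℝ)⌋₊ = a ^ 2 * b)) with hP
  have hcard : ∑ a ∈ Ioc ⌊B⌋₊ N, ∑ b ∈ Ioc (K a) (M a),
      (((Icc 1 ⌊x⌋₊).filter (fun n : ℕ => ⌊x / (n : ℝ)⌋₊ = a ^ 2 * b)).card : ℝ) = P.card := by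
    rw [hP, card_sigma]; simp only [card_sigma]; push_cast; rfl
  have hmem : ∀ q ∈ P, 0 < q.1 ∧ 0 < q.2.1 ∧ 0 < q.2.2 ∧ (q.2.2 : ℝ) ≤ x / B ^ 2 ∧
      ⌊x / (q.2.2 : ℝ)⌋₊ = q.1 ^ 2 * q.2.1 := by
    rintro ⟨a, b, n⟩ hq
    simp only [hP, mem_sigma, mem_filter, mem_Ioc, mem_Icc] at hq
    obtain ⟨⟨ha, -⟩, ⟨hb, -⟩, ⟨hn, -⟩, hfl⟩ := hq
    have hb1 : 0 < b := by omega
    have hb0 : (1 : ℝ) ≤ b := by exact_mod_cast hb1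
    have hn0 : (0 : ℝ) < n := by exact_mod_cast hn
    have ha' : B < a := (Nat.floor_lt hB.le).1 ha
    refine ⟨(Nat.zero_le _).trans_lt ha, hb1, hn, ?_, hfl⟩
    have h := Nat.floor_le (show 0 ≤ x / (n : ℝ) by positivity)
    rw [hfl, le_div_iff₀ hn0] at h
    push_cast at h
    simp only
    rw [le_div_iff₀ (by positivity)]
    have h1 : B ^ 2 ≤ (a : ℝ) ^ 2 * b := by
      have : B ^ 2 ≤ (a : ℝ) ^ 2 := by gcongr
      nlinarith
    calc (n : ℝ) * B ^ 2 ≤ n * ((a : ℝ) ^ 2 * b) := by gcongr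
      _ ≤ x := by linarith
  have hmaps : ∀ q ∈ P, q.2.2 ∈ Ioc 0 ⌊x / B ^ 2⌋₊ := by
    intro q hq
    obtain ⟨-, -, h3, h4, -⟩ := hmem q hq
    rw [mem_Ioc, Nat.le_floor_iff (by positivity)]
    exact ⟨h3, h4⟩
  have hfib : ∀ n ∈ Ioc 0 ⌊x / B ^ 2⌋₊, ((P.filter fun q => q.2.2 = n).card : ℝ) ≤ T := by
    intro n hn
    rcases (P.filter fun q => q.2.2 = n).eq_empty_or_nonempty with h0 | ⟨q₀, hq₀⟩
    · rw [h0]; simpa using hT0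
    rw [mem_filter] at hq₀
    obtain ⟨h1, h2, h3, -, h5⟩ := hmem q₀ hq₀.1
    rw [hq₀.2] at h5 h3
    set m := ⌊x / (n : ℝ)⌋₊ with hm
    have hm0 : 0 < m := by rw [h5]; positivity
    have hmx : (m : ℝ) ≤ x :=
      (Nat.floor_le (by positivity)).trans (div_le_self hx (by exact_mod_cast h3))
    refine le_trans ?_ (hT m hm0 hmx)
    norm_cast
    refine card_le_card_of_injOn (fun q => q.1) ?_ ?_
    · intro q hq
      rw [mem_coe, mem_filter] at hq
      have h := (hmem q hq.1).2.2.2.2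
      rw [hq.2] at h
      rw [mem_coe, Nat.mem_divisors]
      refine ⟨⟨q.1 * q.2.1, ?_⟩, hm0.ne'⟩
      rw [hm, h]; ring
    · rintro ⟨a, b, k⟩ hq ⟨a', b', k'⟩ hq' h
      rw [mem_coe, mem_filter] at hq hq'
      obtain ⟨g1, -, -, -, g5⟩ := hmem _ hq.1
      obtain ⟨-, -, -, -, g5'⟩ := hmem _ hq'.1
      simp only at h hq hq' g1 g5 g5'
      obtain ⟨-, rfl⟩ := hq
      obtain ⟨-, rfl⟩ := hq'
      subst h
      have := Nat.eq_of_mul_eq_mul_left (show 0 < a ^ 2 by positivity) (g5.symm.trans g5')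
      rw [this]
  rw [hcard, card_eq_sum_card_fiberwise hmaps]
  push_cast
  refine (sum_le_sum hfib).trans ?_
  rw [sum_const, nsmul_eq_mul, Nat.card_Ioc, Nat.sub_zero]
  gcongr
  exact Nat.floor_le (by positivity)

theorem sum_abs_sum_floorError_small_le {u : ℝ} (hu : 1 ≤ u) :
    ∑ a ∈ Ioc 0 ⌊u ^ 4⌋₊, |∑ b ∈ Ioc 0 (⌊u ^ 29⌋₊ / a ^ 2), floorError (u ^ 29) (a ^ 2 * b)|
      ≤ 600000 * u ^ 11 * (1 + Real.log (u ^ 29)) ^ 2 := by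
  have hu0 : 0 < u := by linarith
  have hx : 1 ≤ u ^ 29 := one_le_pow₀ hu
  refine (sum_le_sum fun a ha => abs_sum_floorError_sq_mul_le hx (mem_Ioc.1 ha).1).trans ?_
  rw [← sum_mul, ← mul_sum, ← mul_sum]
  have h1 : ∑ a ∈ Ioc 0 ⌊u ^ 4⌋₊, (a : ℝ) ^ (-(2 / 3) : ℝ) ≤ 3 * (u ^ 4) ^ (1 / 3 : ℝ) := by
    refine (sum_Ioc_rpow_neg_two_thirds_le _).trans ?_
    have := Nat.floor_le (show 0 ≤ u ^ 4 by positivity)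
    gcongr
  have h2 : (u ^ 29) ^ (1 / 3 : ℝ) * (u ^ 4) ^ (1 / 3 : ℝ) = u ^ 11 := by
    rw [← Real.mul_rpow (by positivity) (by positivity), ← pow_add, ← Real.rpow_natCast,
      ← Real.rpow_mul hu0.le, ← Real.rpow_natCast]
    norm_num
  have h3 := mul_le_mul_of_nonneg_left h1 (show 0 ≤ (u ^ 29) ^ (1 / 3 : ℝ) by positivity)
  have h4 : (u ^ 29) ^ (1 / 3 : ℝ) * ∑ a ∈ Ioc 0 ⌊u ^ 4⌋₊, (a : ℝ) ^ (-(2 / 3) : ℝ)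
      ≤ 3 * u ^ 11 := by linarith
  have h5 : 600000 * u ^ 11 * (1 + Real.log (u ^ 29)) ^ 2
      = 200000 * (3 * u ^ 11) * (1 + Real.log (u ^ 29)) ^ 2 := by ring
  rw [h5]
  gcongr

theorem sum_abs_sum_floorError_large_le {u C : ℝ} (hu : 1 ≤ u) (hC : 0 ≤ C)
    (hdiv : ∀ m : ℕ, 0 < m → (m : ℝ) ≤ u ^ 29 → (m.divisors.card : ℝ) ≤ C * u) :
    ∑ a ∈ Ioc ⌊u ^ 4⌋₊ ⌊u ^ 29⌋₊,
        |∑ b ∈ Ioc 0 (⌊u ^ 29⌋₊ / a ^ 2), floorError (u ^ 29) (a ^ 2 * b)|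
      ≤ (5 + 4 * C) * u ^ 11 * (1 + Real.log (u ^ 29)) := by
  have hu0 : 0 < u := by linarith
  set x := u ^ 29 with hx
  have hx1 : 1 ≤ x := one_le_pow₀ hu
  have hx0 : 0 ≤ x := by linarith
  have hlog : 0 ≤ Real.log x := Real.log_nonneg hx1
  have hT0 : 0 ≤ C * u := by positivity
  set c : ℕ → ℝ := fun a => ∑ b ∈ Ioc ⌊u ^ 11 / a⌋₊ (⌊x⌋₊ / a ^ 2),
    (((Icc 1 ⌊x⌋₊).filter (fun n : ℕ => ⌊x / (n : ℝ)⌋₊ = a ^ 2 * b)).card : ℝ) with hc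
  have hc0 : ∀ a, 0 ≤ c a := fun a => sum_nonneg fun _ _ => by positivity
  have hcube : ∀ M : ℕ, x / u ^ 11 * ∑ a ∈ Ioc ⌊u ^ 4⌋₊ M, 1 / (a : ℝ) ^ 3 ≤ 2 * u ^ 10 := by
    intro M
    calc _ ≤ x / u ^ 11 * (2 / (u ^ 4) ^ 2) := by
          gcongr; exact sum_Ioc_inv_cube_le_div (by positivity) M
      _ = 2 * u ^ 10 := by rw [hx]; field_simp
  have h1 : ∀ a ∈ Ioc ⌊u ^ 4⌋₊ ⌊x⌋₊,
      |∑ b ∈ Ioc 0 (⌊x⌋₊ / a ^ 2), floorError x (a ^ 2 * b)|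
        ≤ u ^ 11 * (1 / a) + 2 * x / u ^ 11 * (1 / (a : ℝ) ^ 3) + c a := fun a ha =>
    abs_sum_floorError_sq_mul_le_of_split hx0 (by positivity)
      ((Nat.zero_le _).trans_lt (mem_Ioc.1 ha).1) _
  have hmid : ∑ a ∈ Ioc ⌊u ^ 4⌋₊ ⌊u ^ 10⌋₊, c a ≤ 3 * C * u ^ 11 := by
    have h2 : ∀ a ∈ Ioc ⌊u ^ 4⌋₊ ⌊u ^ 10⌋₊, c a ≤ (1 + x / u ^ 11 * (1 / (a : ℝ) ^ 3)) * (C * u) :=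
      fun a ha => sum_card_filter_floor_div_le hx0 (by positivity) hdiv hT0
        ((Nat.zero_le _).trans_lt (mem_Ioc.1 ha).1) _
    refine (sum_le_sum h2).trans ?_
    rw [← sum_mul, sum_add_distrib, ← mul_sum, sum_const, Nat.card_Ioc, nsmul_eq_mul, mul_one]
    have h3 : ((⌊u ^ 10⌋₊ - ⌊u ^ 4⌋₊ : ℕ) : ℝ) ≤ u ^ 10 := by
      refine le_trans ?_ (Nat.floor_le (by positivity))
      exact_mod_cast Nat.sub_le _ _
    calc _ ≤ (u ^ 10 + 2 * u ^ 10) * (C * u) :=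
          mul_le_mul_of_nonneg_right (add_le_add h3 (hcube _)) hT0
      _ = 3 * C * u ^ 11 := by ring
  have htail : ∑ a ∈ Ioc ⌊u ^ 10⌋₊ ⌊x⌋₊, c a ≤ C * u ^ 11 := by
    refine (sum_sum_card_filter_floor_div_le hx0 (show 0 < u ^ 10 by positivity) hdiv hT0 _ _
      _).trans ?_
    calc x / (u ^ 10) ^ 2 * (C * u) = C * u ^ 10 := by rw [hx]; field_simp
      _ ≤ C * u ^ 11 := by gcongr; norm_num
  have hcsum : ∑ a ∈ Ioc ⌊u ^ 4⌋₊ ⌊x⌋₊, c a ≤ 4 * C * u ^ 11 := by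
    have h4 : ⌊u ^ 4⌋₊ ≤ ⌊u ^ 10⌋₊ :=
      Nat.floor_le_floor (pow_le_pow_right₀ hu (by norm_num))
    have h5 : ⌊u ^ 10⌋₊ ≤ ⌊x⌋₊ := Nat.floor_le_floor (pow_le_pow_right₀ hu (by norm_num))
    rw [← sum_Ioc_consecutive _ h4 h5]
    linarith
  have hinv := sum_Ioc_inv_le_one_add_log hx1 ⌊u ^ 4⌋₊
  have hinv' := mul_le_mul_of_nonneg_left hinv (show 0 ≤ u ^ 11 by positivity)
  have hcube' := hcube ⌊x⌋₊
  have hpow : u ^ 10 ≤ u ^ 11 := pow_le_pow_right₀ hu (by norm_num)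
  refine (sum_le_sum h1).trans ?_
  rw [sum_add_distrib, sum_add_distrib, ← mul_sum, ← mul_sum]
  have e : 2 * x / u ^ 11 * ∑ a ∈ Ioc ⌊u ^ 4⌋₊ ⌊x⌋₊, 1 / (a : ℝ) ^ 3
      = 2 * (x / u ^ 11 * ∑ a ∈ Ioc ⌊u ^ 4⌋₊ ⌊x⌋₊, 1 / (a : ℝ) ^ 3) := by ring
  rw [e]
  have hlast : 0 ≤ (4 + 4 * C) * u ^ 11 * Real.log x := by positivity
  nlinarith

theorem abs_sum_muk_two_floor_sub_le {x : ℝ} (hx : 0 ≤ x) :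
    |(∑ n ∈ Icc 1 ⌊x⌋₊, muk 2 ⌊x / (n : ℝ)⌋₊)
        - (∑' n : ℕ, muk 2 (n + 1) / (((n : ℝ) + 1) * ((n : ℝ) + 2))) * x|
      ≤ (∑ a ∈ Ioc 0 ⌊x⌋₊, |∑ b ∈ Ioc 0 (⌊x⌋₊ / a ^ 2), floorError x (a ^ 2 * b)|) + 1 := by
  set c := ∑' n : ℕ, muk 2 (n + 1) / (((n : ℝ) + 1) * ((n : ℝ) + 2))
  set s := ∑ d ∈ Ioc 0 ⌊x⌋₊, muk 2 d * (1 / (d : ℝ) - 1 / (d + 1)) with hs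
  have h1 : (∑ n ∈ Icc 1 ⌊x⌋₊, muk 2 ⌊x / (n : ℝ)⌋₊) - s * x
      = ∑ d ∈ Ioc 0 ⌊x⌋₊, muk 2 d * floorError x d := by
    rw [sum_floor_div_eq hx, hs, sum_mul, ← sum_sub_distrib]
    refine sum_congr rfl fun d _ => ?_
    rw [floorError]
    ring
  have h2 : |(c - s) * x| ≤ 1 := by
    rw [abs_mul, abs_of_nonneg hx]
    refine (mul_le_mul_of_nonneg_right (abs_tsum_muk_two_sub_le ⌊x⌋₊) hx).trans ?_
    rw [one_div, inv_mul_le_iff₀ (by positivity), mul_one]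
    exact (Nat.lt_floor_add_one x).le
  have h3 : |∑ d ∈ Ioc 0 ⌊x⌋₊, muk 2 d * floorError x d|
      ≤ ∑ a ∈ Ioc 0 ⌊x⌋₊, |∑ b ∈ Ioc 0 (⌊x⌋₊ / a ^ 2), floorError x (a ^ 2 * b)| := by
    rw [sum_Ioc_muk_two_mul]
    refine (abs_sum_le_sum_abs _ _).trans (sum_le_sum fun a _ => ?_)
    rw [abs_mul]
    refine mul_le_of_le_one_left (abs_nonneg _) ?_
    exact_mod_cast ArithmeticFunction.abs_moebius_le_one
  calc _ = |((∑ n ∈ Icc 1 ⌊x⌋₊, muk 2 ⌊x / (n : ℝ)⌋₊) - s * x) - (c - s) * x| := by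
        congr 1; ring
    _ ≤ _ := by
        refine (abs_sub _ _).trans ?_
        rw [h1]
        linarith

/-- With `μ₂` the indicator of squarefree numbers,
`∑_{n ≤ x} μ₂(⌊x/n⌋) = C x + O(x^{11/29} (log x)²)` as `x → ∞`, where
`C = ∑_{n=1}^∞ μ₂(n)/(n(n+1))`. -/
theorem squarefree_floor_sum_asymptotic :
    (fun x : ℝ => (∑ n ∈ Finset.Icc 1 ⌊x⌋₊, muk 2 ⌊x / (n : ℝ)⌋₊) -
        (∑' n : ℕ, muk 2 (n + 1) / (((n : ℝ) + 1) * ((n : ℝ) + 2))) * x)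
      =O[atTop] fun x : ℝ => x ^ ((11 : ℝ) / 29) * (Real.log x) ^ 2 := by
  obtain ⟨C, hC, hdiv⟩ := exists_card_divisors_le_rpow (show (0 : ℝ) < 1 / 29 by norm_num)
  refine IsBigO.of_bound (4 * (600006 + 4 * C)) ?_
  filter_upwards [eventually_ge_atTop (Real.exp 1)] with x hx
  have hx1 : 1 ≤ x := (Real.one_le_exp zero_le_one).trans hx
  have hx0 : 0 ≤ x := by linarith
  have hlog1 : 1 ≤ Real.log x := by
    rw [Real.le_log_iff_exp_le (by linarith)]; exact hx
  set u := x ^ (1 / 29 : ℝ) with hu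
  have hu1 : 1 ≤ u := Real.one_le_rpow hx1 (by norm_num)
  have hux : u ^ 29 = x := by
    rw [hu, ← Real.rpow_natCast, ← Real.rpow_mul hx0]; norm_num
  have hu11 : x ^ ((11 : ℝ) / 29) = u ^ 11 := by
    rw [hu, ← Real.rpow_natCast, ← Real.rpow_mul hx0]; norm_num
  have hdiv' : ∀ m : ℕ, 0 < m → (m : ℝ) ≤ u ^ 29 → (m.divisors.card : ℝ) ≤ C * u := by
    intro m hm hmx
    refine (hdiv m hm).trans ?_
    rw [hux] at hmx
    rw [hu]
    gcongr
  have h1 := sum_abs_sum_floorError_small_le hu1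
  have h2 := sum_abs_sum_floorError_large_le hu1 hC hdiv'
  have h3 := abs_sum_muk_two_floor_sub_le hx0
  have h4 : ⌊u ^ 4⌋₊ ≤ ⌊x⌋₊ := by
    rw [← hux]; exact Nat.floor_le_floor (pow_le_pow_right₀ hu1 (by norm_num))
  rw [← sum_Ioc_consecutive _ (Nat.zero_le _) h4] at h3
  rw [hux] at h1 h2
  rw [Real.norm_eq_abs, Real.norm_of_nonneg (by positivity), hu11]
  refine h3.trans ?_
  have hu11' : 1 ≤ u ^ 11 := one_le_pow₀ hu1
  have h5 : 1 + Real.log x ≤ (1 + Real.log x) ^ 2 := le_self_pow₀ (by linarith) (by norm_num)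
  have h6 : (1 + Real.log x) ^ 2 ≤ 4 * Real.log x ^ 2 := by nlinarith
  have h7 : 1 ≤ u ^ 11 * (1 + Real.log x) ^ 2 := by nlinarith
  have h8 : (5 + 4 * C) * u ^ 11 * (1 + Real.log x)
      ≤ (5 + 4 * C) * u ^ 11 * (1 + Real.log x) ^ 2 := by gcongr
  calc _ ≤ (600006 + 4 * C) * u ^ 11 * (1 + Real.log x) ^ 2 := by linarith
    _ ≤ (600006 + 4 * C) * u ^ 11 * (4 * Real.log x ^ 2) := by gcongr
    _ = _ := by ring
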